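/- arXiv:1201.5084 — 8 statements merged into one kernel-verified Lean document; each statement's English description precedes it below -/
import Mathlib

section
/- For every real number t > 0 and every H in (1/2, 1), the series h_t = Σ_{j∈ℤ} (b a^j t)^{-2H} (e^{-b a^j t} - 1 + b a^j t) converges, satisfies the bounds C₁(a,H) < h_t < C₂(a,H) with C₁(a,H) = a^{2H-1} Γ(2-2H) / ((1 - a^{2H-1}) · 2H) and C₂(a,H) = a^{1-2H} C₁(a,H), and satisfies the log-periodicity relation h_{a t} = h_t. -/
open Real

/-- The oscillatory function `h_t = Σ_{j∈ℤ} (b a^j t)^{-2H} (e^{-b a^j t} - 1 + b a^j t)`. -/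
noncomputable def hosc (a b H t : ℝ) : ℝ :=
  ∑' j : ℤ, (b * a ^ j * t) ^ (-(2 * H)) *
    (Real.exp (-(b * a ^ j * t)) - 1 + b * a ^ j * t)

open Filter Topology

namespace HoscProof

/-- the summand -/
noncomputable def f (H x : ℝ) : ℝ := x ^ (-(2 * H)) * (Real.exp (-x) - 1 + x)

noncomputable def G (H x : ℝ) : ℝ := ∫ s in (0:ℝ)..x, Real.exp (-s) * s ^ (2 - 2 * H - 1)

noncomputable def B (H x : ℝ) : ℝ :=
  -((2 * H - 1) / (2 * H)) * f H x - x ^ (1 - 2 * H) * (1 - Real.exp (-x)) / (2 * H)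
    + G H x / (2 * H)

lemma num_nonneg (x : ℝ) : 0 ≤ Real.exp (-x) - 1 + x := by
  have := Real.add_one_le_exp (-x); linarith

lemma num_le_sq {x : ℝ} (hx : 0 < x) : Real.exp (-x) - 1 + x ≤ x ^ 2 := by
  have h1 : Real.exp (-x) ≤ 1 / (1 + x) := by
    rw [Real.exp_neg, ← one_div]
    apply one_div_le_one_div_of_le (by linarith)
    have := Real.add_one_le_exp x; linarith
  have h2 : 1 / (1 + x) - 1 + x ≤ x ^ 2 := by
    rw [div_sub_one (by linarith), div_add' _ _ _ (by linarith), div_le_iff₀ (by linarith)]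
    nlinarith [pow_pos hx 3]
  linarith

lemma f_nonneg {H x : ℝ} (hx : 0 < x) : 0 ≤ f H x :=
  mul_nonneg (Real.rpow_nonneg hx.le _) (num_nonneg x)

lemma f_le_zero {H x : ℝ} (hx : 0 < x) : f H x ≤ x ^ (2 - 2 * H) := by
  have : x ^ (2 - 2 * H) = x ^ (-(2 * H)) * x ^ 2 := by
    rw [← Real.rpow_natCast x 2, ← Real.rpow_add hx]; congr 1; push_cast; ring
  rw [this]
  exact mul_le_mul_of_nonneg_left (num_le_sq hx) (Real.rpow_nonneg hx.le _)

lemma rpow_one_sub {H x : ℝ} (hx : 0 < x) : x ^ (1 - 2 * H) = x ^ (-(2 * H)) * x := by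
  nth_rewrite 3 [← Real.rpow_one x]
  rw [← Real.rpow_add hx]; congr 1; ring

lemma f_le_inf {H x : ℝ} (hx : 0 < x) : f H x ≤ x ^ (1 - 2 * H) := by
  rw [rpow_one_sub hx]
  apply mul_le_mul_of_nonneg_left _ (Real.rpow_nonneg hx.le _)
  have : Real.exp (-x) ≤ 1 := Real.exp_le_one_iff.2 (by linarith)
  linarith

lemma e_nonneg {H x : ℝ} (hx : 0 < x) : 0 ≤ x ^ (1 - 2 * H) * (1 - Real.exp (-x)) := by
  have : Real.exp (-x) ≤ 1 := Real.exp_le_one_iff.2 (by linarith)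
  exact mul_nonneg (Real.rpow_nonneg hx.le _) (by linarith)

lemma e_le_zero {H x : ℝ} (hx : 0 < x) :
    x ^ (1 - 2 * H) * (1 - Real.exp (-x)) ≤ x ^ (2 - 2 * H) := by
  have : x ^ (2 - 2 * H) = x ^ (1 - 2 * H) * x := by
    nth_rewrite 3 [← Real.rpow_one x]
    rw [← Real.rpow_add hx]; congr 1; ring
  rw [this]
  apply mul_le_mul_of_nonneg_left _ (Real.rpow_nonneg hx.le _)
  linarith [num_nonneg x]

lemma e_le_inf {H x : ℝ} (hx : 0 < x) :
    x ^ (1 - 2 * H) * (1 - Real.exp (-x)) ≤ x ^ (1 - 2 * H) := by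
  apply mul_le_of_le_one_right (Real.rpow_nonneg hx.le _)
  linarith [Real.exp_pos (-x)]

lemma integ {H : ℝ} (hH2 : H < 1) :
    MeasureTheory.IntegrableOn (fun s : ℝ => Real.exp (-s) * s ^ (2 - 2 * H - 1)) (Set.Ioi 0) :=
  Real.GammaIntegral_convergent (by linarith)

lemma G_inf {H : ℝ} (hH2 : H < 1) :
    Tendsto (G H) atTop (𝓝 (Real.Gamma (2 - 2 * H))) := by
  rw [Real.Gamma_eq_integral (by linarith)]
  exact MeasureTheory.intervalIntegral_tendsto_integral_Ioi 0 (integ hH2) tendsto_id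

lemma iinteg {H : ℝ} (hH2 : H < 1) {x : ℝ} (hx : 0 < x) :
    IntervalIntegrable (fun s : ℝ => Real.exp (-s) * s ^ (2 - 2 * H - 1))
      MeasureTheory.volume 0 x := by
  rw [intervalIntegrable_iff_integrableOn_Ioc_of_le hx.le]
  exact (integ hH2).mono_set Set.Ioc_subset_Ioi_self

lemma G_zero {H : ℝ} (hH2 : H < 1) : Tendsto (G H) (𝓝[>] 0) (𝓝 0) := by
  have h := intervalIntegral.continuousOn_primitive_interval'
    (iinteg hH2 one_pos) (a := 0) (by simp)
  have h0 := h 0 (by simp)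
  rw [ContinuousWithinAt, intervalIntegral.integral_same] at h0
  apply h0.mono_left
  rw [Set.uIcc_of_le zero_le_one]
  apply nhdsWithin_le_of_mem
  exact Icc_mem_nhdsGT one_pos

lemma G_deriv {H : ℝ} (hH2 : H < 1) {x : ℝ} (hx : 0 < x) :
    HasDerivAt (G H) (Real.exp (-x) * x ^ (2 - 2 * H - 1)) x := by
  have hc : ContinuousOn (fun s : ℝ => Real.exp (-s) * s ^ (2 - 2 * H - 1)) (Set.Ioi 0) := by
    intro y hy
    apply ContinuousAt.continuousWithinAt
    exact (by fun_prop : ContinuousAt (fun s : ℝ => Real.exp (-s)) y).mul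
      (Real.continuousAt_rpow_const y _ (Or.inl (ne_of_gt hy)))
  apply intervalIntegral.integral_hasDerivAt_right (iinteg hH2 hx)
  · exact hc.stronglyMeasurableAtFilter isOpen_Ioi x hx
  · exact hc.continuousAt (Ioi_mem_nhds hx)

lemma B_zero {H : ℝ} (hH2 : H < 1) : Tendsto (B H) (𝓝[>] 0) (𝓝 0) := by
  have hp : Tendsto (fun x : ℝ => x ^ (2 - 2 * H)) (𝓝[>] 0) (𝓝 0) := by
    have := (Real.continuousAt_rpow_const 0 (2 - 2 * H) (Or.inr (by linarith))).tendsto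
    rw [Real.zero_rpow (by linarith)] at this
    exact this.mono_left nhdsWithin_le_nhds
  have h1 : Tendsto (f H) (𝓝[>] 0) (𝓝 0) := by
    refine tendsto_of_tendsto_of_tendsto_of_le_of_le' tendsto_const_nhds hp ?_ ?_ <;>
    filter_upwards [self_mem_nhdsWithin] with x hx
    · exact f_nonneg hx
    · exact f_le_zero hx
  have h2 : Tendsto (fun x : ℝ => x ^ (1 - 2 * H) * (1 - Real.exp (-x))) (𝓝[>] 0) (𝓝 0) := by
    refine tendsto_of_tendsto_of_tendsto_of_le_of_le' tendsto_const_nhds hp ?_ ?_ <;>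
    filter_upwards [self_mem_nhdsWithin] with x hx
    · exact e_nonneg hx
    · exact e_le_zero hx
  have := ((h1.const_mul (-((2 * H - 1) / (2 * H)))).sub (h2.div_const (2 * H))).add
    ((G_zero hH2).div_const (2 * H))
  simp only [mul_zero, zero_div, sub_zero, zero_add, add_zero] at this
  exact this

lemma B_inf {H : ℝ} (hH1 : 1 / 2 < H) (hH2 : H < 1) :
    Tendsto (B H) atTop (𝓝 (Real.Gamma (2 - 2 * H) / (2 * H))) := by
  have hp : Tendsto (fun x : ℝ => x ^ (1 - 2 * H)) atTop (𝓝 0) := by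
    have := tendsto_rpow_neg_atTop (y := 2 * H - 1) (by linarith)
    simpa using this
  have h1 : Tendsto (f H) atTop (𝓝 0) := by
    refine tendsto_of_tendsto_of_tendsto_of_le_of_le' tendsto_const_nhds hp ?_ ?_ <;>
    filter_upwards [eventually_gt_atTop 0] with x hx
    · exact f_nonneg hx
    · exact f_le_inf hx
  have h2 : Tendsto (fun x : ℝ => x ^ (1 - 2 * H) * (1 - Real.exp (-x))) atTop (𝓝 0) := by
    refine tendsto_of_tendsto_of_tendsto_of_le_of_le' tendsto_const_nhds hp ?_ ?_ <;>
    filter_upwards [eventually_gt_atTop 0] with x hx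
    · exact e_nonneg hx
    · exact e_le_inf hx
  have := ((h1.const_mul (-((2 * H - 1) / (2 * H)))).sub (h2.div_const (2 * H))).add
    ((G_inf hH2).div_const (2 * H))
  simp only [mul_zero, zero_div, sub_zero, zero_add, add_zero] at this
  exact this

noncomputable def g (x : ℝ) : ℝ := (Real.exp (-x) - 1 + x) / x

lemma g_lt {x y : ℝ} (hx : 0 < x) (hxy : x < y) : g x < g y := by
  have hy : 0 < y := hx.trans hxy
  have := strictConvexOn_exp.secant_strict_mono (a := 0) (x := -y) (y := -x)
    (Set.mem_univ _) (Set.mem_univ _) (Set.mem_univ _) (by linarith) (by linarith) (by linarith)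
  simp only [Real.exp_zero, sub_zero, div_neg] at this
  unfold g
  rw [add_div, add_div, div_self hx.ne', div_self hy.ne']
  linarith

lemma f_eq {H x : ℝ} (hx : 0 < x) : f H x = x ^ (1 - 2 * H) * g x := by
  rw [rpow_one_sub hx, f, g]
  field_simp

lemma B_deriv {H : ℝ} (hH1 : 1 / 2 < H) (hH2 : H < 1) {x : ℝ} (hx : 0 < x) :
    HasDerivAt (B H) ((2 * H - 1) * x ^ (-(2 * H)) * g x) x := by
  have he : HasDerivAt (fun x : ℝ => Real.exp (-x)) (-Real.exp (-x)) x := by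
    simpa using (hasDerivAt_neg x).exp
  have hp1 := Real.hasDerivAt_rpow_const (x := x) (p := -(2 * H)) (Or.inl hx.ne')
  have hp2 := Real.hasDerivAt_rpow_const (x := x) (p := 1 - 2 * H) (Or.inl hx.ne')
  have hf := hp1.mul ((he.sub_const 1).add (hasDerivAt_id x))
  have hE := hp2.mul (he.const_sub 1)
  have := ((hf.const_mul (-((2 * H - 1) / (2 * H)))).sub (hE.div_const (2 * H))).add
    ((G_deriv hH2 hx).div_const (2 * H))
  refine HasDerivAt.congr_deriv this ?_
  have e1 : x ^ (-(2 * H) - 1) = x ^ (-(2 * H)) / x := Real.rpow_sub_one hx.ne' _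
  have e2 : x ^ (1 - 2 * H) = x ^ (-(2 * H)) * x := rpow_one_sub hx
  have e3 : (1 - 2 * H - 1) = -(2 * H) := by ring
  have e4 : (2 - 2 * H - 1) = 1 - 2 * H := by ring
  have hH : H ≠ 0 := by linarith
  simp only [e3, e4, e1, e2, g, id, Pi.add_apply]
  field_simp
  ring

/-- Comparison on an interval. -/
lemma B_aux {H : ℝ} (hH1 : 1 / 2 < H) (hH2 : H < 1) {x y : ℝ} (hx : 0 < x) (hxy : x < y) :
    g x * (x ^ (1 - 2 * H) - y ^ (1 - 2 * H)) < B H y - B H x ∧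
    B H y - B H x < g y * (x ^ (1 - 2 * H) - y ^ (1 - 2 * H)) := by
  have hd : ∀ k : ℝ, ∀ z : ℝ, 0 < z → HasDerivAt (fun z => B H z + k * z ^ (1 - 2 * H))
      ((2 * H - 1) * z ^ (-(2 * H)) * (g z - k)) z := by
    intro k z hz
    have hp2 := Real.hasDerivAt_rpow_const (x := z) (p := 1 - 2 * H) (Or.inl hz.ne')
    have e3 : (1 - 2 * H - 1) = -(2 * H) := by ring
    refine ((B_deriv hH1 hH2 hz).add (hp2.const_mul k)).congr_deriv ?_
    rw [e3]; ring
  have hcont : ∀ k : ℝ, ContinuousOn (fun z => B H z + k * z ^ (1 - 2 * H)) (Set.Icc x y) :=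
    fun k z hz => (hd k z (hx.trans_le hz.1)).continuousAt.continuousWithinAt
  constructor
  · have := strictMonoOn_of_deriv_pos (convex_Icc x y) (hcont (g x)) (by
      intro z hz
      rw [interior_Icc] at hz
      have hz0 := hx.trans hz.1
      rw [(hd _ z hz0).deriv]
      have := g_lt hx hz.1
      have := Real.rpow_pos_of_pos hz0 (-(2 * H))
      apply mul_pos (mul_pos (by linarith) this) (by linarith))
    have := this (Set.left_mem_Icc.2 hxy.le) (Set.right_mem_Icc.2 hxy.le) hxy
    simp only at this
    linarith
  · have := strictAntiOn_of_deriv_neg (convex_Icc x y) (hcont (g y)) (by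
      intro z hz
      rw [interior_Icc] at hz
      have hz0 := hx.trans hz.1
      rw [(hd _ z hz0).deriv]
      have := g_lt hz0 hz.2
      have := Real.rpow_pos_of_pos hz0 (-(2 * H))
      apply mul_neg_of_pos_of_neg (mul_pos (by linarith) this) (by linarith))
    have := this (Set.left_mem_Icc.2 hxy.le) (Set.right_mem_Icc.2 hxy.le) hxy
    simp only at this
    linarith

lemma B_step {a H : ℝ} (ha0 : 0 < a) (ha1 : a < 1) (hH1 : 1 / 2 < H) (hH2 : H < 1)
    {y : ℝ} (hy : 0 < y) :
    (1 - a ^ (2 * H - 1)) * f H (a * y) < B H y - B H (a * y) ∧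
    B H y - B H (a * y) < (a ^ (1 - 2 * H) - 1) * f H y := by
  have hay : 0 < a * y := mul_pos ha0 hy
  have h := B_aux hH1 hH2 hay (by nlinarith : a * y < y)
  have e : (a * y) ^ (1 - 2 * H) = a ^ (1 - 2 * H) * y ^ (1 - 2 * H) :=
    Real.mul_rpow ha0.le hy.le
  have e1 : a ^ (2 * H - 1) * a ^ (1 - 2 * H) = 1 := by
    rw [← Real.rpow_add ha0]; simp
  rw [f_eq hy, f_eq hay]
  rw [e] at h ⊢
  constructor
  · refine lt_of_eq_of_lt ?_ h.1
    linear_combination (-g (a * y) * y ^ (1 - 2 * H)) * e1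
  · refine lt_of_lt_of_eq h.2 ?_
    ring

/-- Telescoping over the integers. -/
lemma hasSum_tele (u : ℤ → ℝ) (L : ℝ) (hpos : ∀ j, 0 ≤ u j - u (j + 1))
    (h0 : Tendsto (fun n : ℕ => u n) atTop (𝓝 0))
    (h1 : Tendsto (fun n : ℕ => u (-(n : ℤ))) atTop (𝓝 L)) :
    HasSum (fun j => u j - u (j + 1)) L := by
  have hA : HasSum (fun n : ℕ => u n - u ((n : ℤ) + 1)) (u 0) := by
    rw [hasSum_iff_tendsto_nat_of_nonneg (fun n => hpos n)]
    have : ∀ n : ℕ, ∑ i ∈ Finset.range n, (u i - u ((i : ℤ) + 1)) = u 0 - u n := by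
      intro n
      have := Finset.sum_range_sub' (fun i : ℕ => u i) n
      simpa using this
    simp only [this]
    simpa using h0.const_sub (u 0)
  have hB : HasSum (fun n : ℕ => u (-((n : ℤ) + 1)) - u (-((n : ℤ) + 1) + 1)) (L - u 0) := by
    rw [hasSum_iff_tendsto_nat_of_nonneg (fun n => hpos _)]
    have : ∀ n : ℕ, ∑ i ∈ Finset.range n, (u (-((i : ℤ) + 1)) - u (-((i : ℤ) + 1) + 1))
        = u (-(n : ℤ)) - u 0 := by
      intro n
      have := Finset.sum_range_sub (fun i : ℕ => u (-(i : ℤ))) n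
      simp only [Nat.cast_zero, neg_zero] at this
      rw [← this]
      apply Finset.sum_congr rfl
      intro i _
      push_cast
      congr 2
      ring
    simp only [this]
    exact h1.sub_const (u 0)
  have := HasSum.of_nat_of_neg_add_one (f := fun j => u j - u (j + 1)) hA hB
  simpa using this

end HoscProof

theorem stmt0 (a b : ℝ) (ha0 : 0 < a) (ha1 : a < 1) (hb : 0 < b)
    (H : ℝ) (hH1 : 1 / 2 < H) (hH2 : H < 1) (t : ℝ) (ht : 0 < t) :
    Summable (fun j : ℤ => (b * a ^ j * t) ^ (-(2 * H)) *
      (Real.exp (-(b * a ^ j * t)) - 1 + b * a ^ j * t)) ∧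
    a ^ (2 * H - 1) * Real.Gamma (2 - 2 * H) / ((1 - a ^ (2 * H - 1)) * (2 * H))
      < hosc a b H t ∧
    hosc a b H t < a ^ (1 - 2 * H) *
      (a ^ (2 * H - 1) * Real.Gamma (2 - 2 * H) / ((1 - a ^ (2 * H - 1)) * (2 * H))) ∧
    hosc a b H (a * t) = hosc a b H t := by
  set y : ℤ → ℝ := fun j => b * a ^ j * t with hy
  have ypos : ∀ j, 0 < y j := fun j => mul_pos (mul_pos hb (zpow_pos ha0 j)) ht
  have ysucc : ∀ j, y (j + 1) = a * y j := by
    intro j; simp only [hy]; rw [zpow_add_one₀ ha0.ne']; ring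
  have step : ∀ j, (1 - a ^ (2 * H - 1)) * HoscProof.f H (y (j + 1))
      < HoscProof.B H (y j) - HoscProof.B H (y (j + 1)) ∧
    HoscProof.B H (y j) - HoscProof.B H (y (j + 1)) < (a ^ (1 - 2 * H) - 1) * HoscProof.f H (y j) := by
    intro j
    rw [ysucc]
    exact HoscProof.B_step ha0 ha1 hH1 hH2 (ypos j)
  have hp : a ^ (2 * H - 1) < 1 := Real.rpow_lt_one ha0.le ha1 (by linarith)
  have hp0 : 0 < a ^ (2 * H - 1) := Real.rpow_pos_of_pos ha0 _
  have hc : 0 < 1 - a ^ (2 * H - 1) := by linarith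
  have hpq : a ^ (1 - 2 * H) * a ^ (2 * H - 1) = 1 := by
    rw [← Real.rpow_add ha0]; simp
  have hfn : ∀ j, 0 ≤ HoscProof.f H (y j) := fun j => HoscProof.f_nonneg (ypos j)
  have tele : HasSum (fun j => HoscProof.B H (y j) - HoscProof.B H (y (j + 1)))
      (Real.Gamma (2 - 2 * H) / (2 * H)) := by
    apply HoscProof.hasSum_tele (fun j => HoscProof.B H (y j))
    · intro j
      exact (mul_nonneg hc.le (hfn _)).trans (step j).1.le
    · refine (HoscProof.B_zero hH2).comp (tendsto_nhdsWithin_iff.2 ⟨?_, ?_⟩)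
      · have := ((tendsto_pow_atTop_nhds_zero_of_lt_one ha0.le ha1).const_mul b).mul_const t
        simpa [hy] using this
      · exact Eventually.of_forall fun n => ypos n
    · refine (HoscProof.B_inf hH1 hH2).comp ?_
      have h := tendsto_pow_atTop_atTop_of_one_lt ((one_lt_inv₀ ha0).2 ha1)
      have := (h.const_mul_atTop hb).atTop_mul_const ht
      simpa [hy] using this
  have hs1 : Summable (fun j => HoscProof.f H (y (j + 1))) := by
    have : Summable (fun j => (1 - a ^ (2 * H - 1)) * HoscProof.f H (y (j + 1))) :=
      Summable.of_nonneg_of_le (fun j => mul_nonneg hc.le (hfn _)) (fun j => (step j).1.le)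
        tele.summable
    exact (summable_mul_left_iff hc.ne').1 this
  have hs : Summable (fun j => HoscProof.f H (y j)) :=
    (Equiv.addRight (1 : ℤ)).summable_iff.1 hs1
  have hosc_eq : hosc a b H t = ∑' j, HoscProof.f H (y j) := rfl
  have hshift : ∑' j, HoscProof.f H (y (j + 1)) = ∑' j, HoscProof.f H (y j) :=
    (Equiv.addRight (1 : ℤ)).tsum_eq (fun j => HoscProof.f H (y j))
  have hsum := hs.hasSum
  have hsum1 := hs1.hasSum
  rw [hshift, ← hosc_eq] at hsum1
  rw [← hosc_eq] at hsum
  have up := hasSum_lt (fun j => (step j).1.le) (step 0).1 (hsum1.mul_left _) tele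
  have lo := hasSum_lt (fun j => (step j).2.le) (step 0).2 tele (hsum.mul_left _)
  have hH0 : 0 < 2 * H := by linarith
  have hne : 1 - a ^ (2 * H - 1) ≠ 0 := hc.ne'
  refine ⟨hs, ?_, ?_, ?_⟩
  · have e : a ^ (2 * H - 1) * Real.Gamma (2 - 2 * H) / ((1 - a ^ (2 * H - 1)) * (2 * H))
      = a ^ (2 * H - 1) * (Real.Gamma (2 - 2 * H) / (2 * H)) / (1 - a ^ (2 * H - 1)) := by
      field_simp
    rw [e, div_lt_iff₀ hc]
    refine lt_of_lt_of_eq (mul_lt_mul_of_pos_left lo hp0) ?_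
    linear_combination hosc a b H t * hpq
  · have e : a ^ (1 - 2 * H) * (a ^ (2 * H - 1) * Real.Gamma (2 - 2 * H) /
        ((1 - a ^ (2 * H - 1)) * (2 * H)))
      = (a ^ (1 - 2 * H) * a ^ (2 * H - 1)) * (Real.Gamma (2 - 2 * H) / (2 * H))
        / (1 - a ^ (2 * H - 1)) := by
      field_simp
    rw [e, hpq, one_mul, lt_div_iff₀ hc, mul_comm]
    exact up
  · rw [hosc_eq, ← hshift]
    unfold hosc
    apply tsum_congr
    intro j
    have : b * a ^ j * (a * t) = y (j + 1) := by rw [ysucc]; simp only [hy]; ring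
    rw [this]
    rfl
end

section
/- For every real number t > 0 and every H in (1, 3/2), the series h̃_t = Σ_{j∈ℤ} (b a^j t)^{-2H} (e^{-b a^j t} - 1 + b a^j t - (b a^j t)²/2) converges, is strictly negative, satisfies C₁(a,H) < |h̃_t| < C₂(a,H) with C₁(a,H) = Γ(4-2H) / (2H (2H-1) (2H-2) (a^{2H-3} - 1)) and C₂(a,H) = a^{2H-3} C₁(a,H), and satisfies the log-periodicity relation h̃_{a t} = h̃_t. -/
open Real

/-- The oscillatory function
`h̃_t = Σ_{j∈ℤ} (b a^j t)^{-2H} (e^{-b a^j t} - 1 + b a^j t - (b a^j t)²/2)`. -/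
noncomputable def htil (a b H t : ℝ) : ℝ :=
  ∑' j : ℤ, (b * a ^ j * t) ^ (-(2 * H)) *
    (Real.exp (-(b * a ^ j * t)) - 1 + b * a ^ j * t - (b * a ^ j * t) ^ 2 / 2)

/-- `g x = 1 - x + x²/2 - e^{-x}`. -/
noncomputable def gf (x : ℝ) : ℝ := 1 - x + x ^ 2 / 2 - Real.exp (-x)

lemma hd_exp (x : ℝ) : HasDerivAt (fun x : ℝ => Real.exp (-x)) (-Real.exp (-x)) x := by
  simpa using (hasDerivAt_neg x).exp

lemma hd_gf (x : ℝ) : HasDerivAt gf (Real.exp (-x) - 1 + x) x := by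
  unfold gf
  have h := (((hasDerivAt_const x (1 : ℝ)).sub (hasDerivAt_id x)).add
    ((hasDerivAt_pow 2 x).div_const 2)).sub (hd_exp x)
  refine h.congr_deriv ?_
  norm_num
  ring

lemma hd_g1 (x : ℝ) : HasDerivAt (fun x : ℝ => Real.exp (-x) - 1 + x) (1 - Real.exp (-x)) x := by
  have h := ((hd_exp x).sub (hasDerivAt_const x (1 : ℝ))).add (hasDerivAt_id x)
  refine h.congr_deriv ?_
  ring

lemma hd_g2 (x : ℝ) : HasDerivAt (fun x : ℝ => 1 - Real.exp (-x)) (Real.exp (-x)) x := by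
  have h := (hasDerivAt_const x (1 : ℝ)).sub (hd_exp x)
  refine h.congr_deriv ?_
  ring

/-- positivity from positive derivative -/
lemma pos_of_deriv {f f' : ℝ → ℝ} (h0 : f 0 = 0) (hd : ∀ x, HasDerivAt f (f' x) x)
    (hp : ∀ x, 0 < x → 0 < f' x) {x : ℝ} (hx : 0 < x) : 0 < f x := by
  have hm : StrictMonoOn f (Set.Ici 0) := by
    apply strictMonoOn_of_deriv_pos (convex_Ici 0)
    · exact fun y _ => (hd y).continuousAt.continuousWithinAt
    · intro y hy
      rw [interior_Ici] at hy
      rw [(hd y).deriv]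
      exact hp y hy
  have := hm (Set.mem_Ici.2 le_rfl) (Set.mem_Ici.2 hx.le) hx
  rwa [h0] at this

lemma g2_pos {x : ℝ} (hx : 0 < x) : 0 < 1 - Real.exp (-x) := by
  have : Real.exp (-x) < 1 := by rw [← Real.exp_zero]; exact Real.exp_lt_exp.2 (by linarith)
  linarith

lemma g1_pos {x : ℝ} (hx : 0 < x) : 0 < Real.exp (-x) - 1 + x := by
  have := Real.add_one_lt_exp (x := -x) (by linarith)
  linarith

lemma gf_pos {x : ℝ} (hx : 0 < x) : 0 < gf x :=
  pos_of_deriv (by simp [gf]) hd_gf (fun _ h => g1_pos h) hx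

lemma gf_lt_cube {x : ℝ} (hx : 0 < x) : gf x < x ^ 3 / 6 := by
  have : 0 < (fun x => x ^ 3 / 6 - gf x) x := by
    apply pos_of_deriv (f' := gf) (by simp [gf]) _ (fun _ h => gf_pos h) hx
    intro y
    have h := ((hasDerivAt_pow 3 y).div_const 6).sub (hd_gf y)
    refine h.congr_deriv ?_
    unfold gf
    norm_num
    ring
  simpa using this

lemma key_neg {x : ℝ} (hx : 0 < x) : x * (Real.exp (-x) - 1 + x) - 3 * gf x < 0 := by
  have h2 : ∀ x : ℝ, 0 < x → 0 < (x + 2) * Real.exp (-x) - 2 + x := by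
    intro x hx
    refine pos_of_deriv (f := fun x => (x + 2) * Real.exp (-x) - 2 + x)
      (f' := fun x => 1 - (x + 1) * Real.exp (-x)) (by simp) ?_ ?_ hx
    · intro y
      have h := ((((hasDerivAt_id y).add_const 2).mul (hd_exp y)).sub_const 2).add (hasDerivAt_id y)
      refine h.congr_deriv ?_
      simp
      ring
    · intro y hy
      have h1 := Real.add_one_lt_exp (x := y) hy.ne'
      have h3 : Real.exp y * Real.exp (-y) = 1 := by rw [← Real.exp_add]; simp
      have h4 := Real.exp_pos (-y)
      nlinarith
  have : 0 < (fun x => 3 * gf x - x * (Real.exp (-x) - 1 + x)) x := by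
    refine pos_of_deriv (f := fun x => 3 * gf x - x * (Real.exp (-x) - 1 + x)) (f' := fun x => (x + 2) * Real.exp (-x) - 2 + x) (by simp [gf]) ?_ h2 hx
    intro y
    have h := ((hd_gf y).const_mul 3).sub ((hasDerivAt_id y).mul (hd_g1 y))
    refine h.congr_deriv ?_
    simp
    ring
  simp only at this
  linarith

noncomputable def phi (x : ℝ) : ℝ := gf x / x ^ 3

lemma phi_pos {x : ℝ} (hx : 0 < x) : 0 < phi x := by
  have := gf_pos hx
  unfold phi
  positivity

lemma phi_anti : StrictAntiOn phi (Set.Ioi 0) := by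
  have hd : ∀ y : ℝ, 0 < y → HasDerivAt phi
      ((y * (Real.exp (-y) - 1 + y) - 3 * gf y) / y ^ 4) y := by
    intro y hy
    have h := (hd_gf y).div (hasDerivAt_pow 3 y) (by positivity)
    refine h.congr_deriv ?_
    field_simp
    norm_num
    ring
  apply strictAntiOn_of_deriv_neg (convex_Ioi 0)
  · exact fun y hy => (hd y hy).continuousAt.continuousWithinAt
  · intro y hy
    rw [interior_Ioi] at hy
    rw [(hd y hy).deriv]
    exact div_neg_of_neg_of_pos (key_neg hy) (by have : (0:ℝ) < y := hy; positivity)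

open MeasureTheory Filter Topology in
/-- truncated Gamma integral -/
lemma exists_K {s : ℝ} (hs : 0 < s) : ∃ K : ℝ → ℝ,
    (∀ x, 0 < x → HasDerivAt K (Real.exp (-x) * x ^ (s - 1)) x) ∧
    Tendsto K (𝓝[>] 0) (𝓝 0) ∧ Tendsto K atTop (𝓝 (Real.Gamma s)) := by
  set γ : ℝ → ℝ := fun x => Real.exp (-x) * x ^ (s - 1)
  have hint : Integrable ((Set.Ioi 0).indicator γ) :=
    (integrable_indicator_iff measurableSet_Ioi).2 (Real.GammaIntegral_convergent hs)
  refine ⟨fun x => ∫ v in (0 : ℝ)..x, (Set.Ioi 0).indicator γ v, ?_, ?_, ?_⟩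
  · intro x hx
    have hc : ContinuousAt γ x :=
      (Real.continuous_exp.comp continuous_neg).continuousAt.mul
        (Real.continuousAt_rpow_const x _ (Or.inl hx.ne'))
    have he : (Set.Ioi 0).indicator γ =ᶠ[𝓝 x] γ := by
      filter_upwards [Ioi_mem_nhds hx] with y hy
      exact Set.indicator_of_mem hy γ
    have h := intervalIntegral.integral_hasDerivAt_right (a := 0) (b := x) hint.intervalIntegrable
      (hint.aestronglyMeasurable.stronglyMeasurableAtFilter) (hc.congr he.symm)
    rw [he.eq_of_nhds] at h
    exact h
  · have hc := intervalIntegral.continuous_primitive (fun a b => hint.intervalIntegrable) 0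
    have := (hc.tendsto 0).mono_left (nhdsWithin_le_nhds (s := Set.Ioi 0))
    simpa using this
  · have h := intervalIntegral_tendsto_integral_Ioi 0 hint.integrableOn tendsto_id
    rw [setIntegral_indicator measurableSet_Ioi, Set.inter_self] at h
    rw [Real.Gamma_eq_integral hs]
    exact h

open Filter Topology in
lemma exists_F {s : ℝ} (hs : 0 < s) (hs1 : s < 1) : ∃ F : ℝ → ℝ,
    (∀ x, 0 < x → HasDerivAt F (x ^ (s - 1) * phi x) x) ∧
    Tendsto F (𝓝[>] 0) (𝓝 0) ∧
    Tendsto F atTop (𝓝 (Real.Gamma s / ((1 - s) * (2 - s) * (3 - s)))) := by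
  obtain ⟨K, hK, hK0, hKt⟩ := exists_K hs
  have e1 : (1 - s) ≠ 0 := by linarith
  have e2 : (2 - s) ≠ 0 := by linarith
  have e3 : (3 - s) ≠ 0 := by linarith
  refine ⟨fun x => -(x ^ (s - 3) * gf x) / (3 - s)
    - x ^ (s - 2) * (Real.exp (-x) - 1 + x) / ((3 - s) * (2 - s))
    - x ^ (s - 1) * (1 - Real.exp (-x)) / ((1 - s) * (2 - s) * (3 - s))
    + K x / ((1 - s) * (2 - s) * (3 - s)), ?_, ?_, ?_⟩
  · intro x hx
    have r : ∀ p : ℝ, HasDerivAt (fun x : ℝ => x ^ p) (p * x ^ (p - 1)) x := fun p =>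
      Real.hasDerivAt_rpow_const (Or.inl hx.ne')
    have h := (((((r (s - 3)).mul (hd_gf x)).neg.div_const (3 - s)).sub
      (((r (s - 2)).mul (hd_g1 x)).div_const ((3 - s) * (2 - s)))).sub
      (((r (s - 1)).mul (hd_g2 x)).div_const ((1 - s) * (2 - s) * (3 - s)))).add
      ((hK x hx).div_const ((1 - s) * (2 - s) * (3 - s)))
    refine h.congr_deriv ?_
    have q1 : x ^ (s - 1) = x ^ (s - 4) * x ^ 3 := by
      rw [← Real.rpow_natCast, ← Real.rpow_add hx]; congr 1; norm_num; ring
    have q2 : x ^ (s - 2) = x ^ (s - 4) * x ^ 2 := by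
      rw [← Real.rpow_natCast, ← Real.rpow_add hx]; congr 1; norm_num; ring
    have q3 : x ^ (s - 3) = x ^ (s - 4) * x := by
      nth_rewrite 3 [← Real.rpow_one x]
      rw [← Real.rpow_add hx]; congr 1; ring
    have p3 : s - 3 - 1 = s - 4 := by ring
    have p2 : s - 2 - 1 = s - 3 := by ring
    have p1 : s - 1 - 1 = s - 2 := by ring
    rw [p3, p2, p1, q1, q2, q3]
    unfold phi
    have := hx.ne'
    field_simp
    ring
  · have z : Tendsto (fun x : ℝ => x ^ s) (𝓝[>] 0) (𝓝 0) := by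
      have := (Real.continuousAt_rpow_const 0 s (Or.inr hs.le)).tendsto
      rw [Real.zero_rpow hs.ne'] at this
      exact this.mono_left nhdsWithin_le_nhds
    have t3 : Tendsto (fun x : ℝ => x ^ (s - 3) * gf x) (𝓝[>] 0) (𝓝 0) := by
      refine tendsto_of_tendsto_of_tendsto_of_le_of_le' tendsto_const_nhds z ?_ ?_
      · filter_upwards [self_mem_nhdsWithin] with x (hx : 0 < x)
        exact mul_nonneg (Real.rpow_nonneg hx.le _) (gf_pos hx).le
      · filter_upwards [self_mem_nhdsWithin] with x (hx : 0 < x)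
        have q : x ^ s = x ^ (s - 3) * x ^ 3 := by
          rw [← Real.rpow_natCast, ← Real.rpow_add hx]; congr 1; norm_num
        rw [q]
        have : 0 < x ^ 3 := by positivity
        exact mul_le_mul_of_nonneg_left (by linarith [gf_lt_cube hx]) (Real.rpow_nonneg hx.le _)
    have t2 : Tendsto (fun x : ℝ => x ^ (s - 2) * (Real.exp (-x) - 1 + x)) (𝓝[>] 0) (𝓝 0) := by
      refine tendsto_of_tendsto_of_tendsto_of_le_of_le' tendsto_const_nhds z ?_ ?_
      · filter_upwards [self_mem_nhdsWithin] with x (hx : 0 < x)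
        exact mul_nonneg (Real.rpow_nonneg hx.le _) (g1_pos hx).le
      · filter_upwards [self_mem_nhdsWithin] with x (hx : 0 < x)
        have q : x ^ s = x ^ (s - 2) * x ^ 2 := by
          rw [← Real.rpow_natCast, ← Real.rpow_add hx]; congr 1; norm_num
        rw [q]
        have : 0 < x ^ 2 := by positivity
        have h := gf_pos hx
        unfold gf at h
        exact mul_le_mul_of_nonneg_left (by linarith) (Real.rpow_nonneg hx.le _)
    have t1 : Tendsto (fun x : ℝ => x ^ (s - 1) * (1 - Real.exp (-x))) (𝓝[>] 0) (𝓝 0) := by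
      refine tendsto_of_tendsto_of_tendsto_of_le_of_le' tendsto_const_nhds z ?_ ?_
      · filter_upwards [self_mem_nhdsWithin] with x (hx : 0 < x)
        exact mul_nonneg (Real.rpow_nonneg hx.le _) (g2_pos hx).le
      · filter_upwards [self_mem_nhdsWithin] with x (hx : 0 < x)
        have q : x ^ s = x ^ (s - 1) * x := by
          rw [← Real.rpow_add_one hx.ne']; congr 1; ring
        rw [q]
        exact mul_le_mul_of_nonneg_left (by linarith [g1_pos hx]) (Real.rpow_nonneg hx.le _)
    have := (((t3.neg.div_const (3 - s)).sub (t2.div_const ((3 - s) * (2 - s)))).sub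
      (t1.div_const ((1 - s) * (2 - s) * (3 - s)))).add
      (hK0.div_const ((1 - s) * (2 - s) * (3 - s)))
    simpa using this
  · have z : Tendsto (fun x : ℝ => x ^ (s - 1)) atTop (𝓝 0) := by
      have := tendsto_rpow_neg_atTop (y := 1 - s) (by linarith)
      simpa using this
    have t3 : Tendsto (fun x : ℝ => x ^ (s - 3) * gf x) atTop (𝓝 0) := by
      refine tendsto_of_tendsto_of_tendsto_of_le_of_le' tendsto_const_nhds z ?_ ?_
      · filter_upwards [eventually_gt_atTop 0] with x (hx : 0 < x)
        exact mul_nonneg (Real.rpow_nonneg hx.le _) (gf_pos hx).le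
      · filter_upwards [eventually_gt_atTop 0] with x (hx : 0 < x)
        have q : x ^ (s - 1) = x ^ (s - 3) * x ^ 2 := by
          rw [← Real.rpow_natCast, ← Real.rpow_add hx]; congr 1; norm_num; ring
        rw [q]
        have : 0 < x ^ 2 := by positivity
        refine mul_le_mul_of_nonneg_left ?_ (Real.rpow_nonneg hx.le _)
        unfold gf
        linarith [g1_pos hx]
    have t2 : Tendsto (fun x : ℝ => x ^ (s - 2) * (Real.exp (-x) - 1 + x)) atTop (𝓝 0) := by
      refine tendsto_of_tendsto_of_tendsto_of_le_of_le' tendsto_const_nhds z ?_ ?_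
      · filter_upwards [eventually_gt_atTop 0] with x (hx : 0 < x)
        exact mul_nonneg (Real.rpow_nonneg hx.le _) (g1_pos hx).le
      · filter_upwards [eventually_gt_atTop 0] with x (hx : 0 < x)
        have q : x ^ (s - 1) = x ^ (s - 2) * x := by
          rw [← Real.rpow_add_one hx.ne']; congr 1; ring
        rw [q]
        exact mul_le_mul_of_nonneg_left (by linarith [g2_pos hx]) (Real.rpow_nonneg hx.le _)
    have t1 : Tendsto (fun x : ℝ => x ^ (s - 1) * (1 - Real.exp (-x))) atTop (𝓝 0) := by
      refine tendsto_of_tendsto_of_tendsto_of_le_of_le' tendsto_const_nhds z ?_ ?_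
      · filter_upwards [eventually_gt_atTop 0] with x (hx : 0 < x)
        exact mul_nonneg (Real.rpow_nonneg hx.le _) (g2_pos hx).le
      · filter_upwards [eventually_gt_atTop 0] with x (hx : 0 < x)
        have := Real.exp_pos (-x)
        have := Real.rpow_nonneg hx.le (s - 1)
        nlinarith
    have := (((t3.neg.div_const (3 - s)).sub (t2.div_const ((3 - s) * (2 - s)))).sub
      (t1.div_const ((1 - s) * (2 - s) * (3 - s)))).add
      (hKt.div_const ((1 - s) * (2 - s) * (3 - s)))
    simpa using this

lemma F_bounds {s : ℝ} (hs : 0 < s) {F : ℝ → ℝ}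
    (hF : ∀ x, 0 < x → HasDerivAt F (x ^ (s - 1) * phi x) x) {x y : ℝ} (hy : 0 < y) (hxy : y < x) :
    phi x * (x ^ s - y ^ s) / s < F x - F y ∧ F x - F y < phi y * (x ^ s - y ^ s) / s := by
  have hd : ∀ (c z : ℝ), 0 < z → HasDerivAt (fun z => F z - c * z ^ s / s)
      (z ^ (s - 1) * (phi z - c)) z := by
    intro c z hz
    have h := (hF z hz).sub
      (((Real.hasDerivAt_rpow_const (p := s) (Or.inl hz.ne')).const_mul c).div_const s)
    refine h.congr_deriv ?_
    field_simp
  have hpos : ∀ z ∈ Set.Icc y x, 0 < z := fun z hz => lt_of_lt_of_le hy hz.1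
  constructor
  · have hm : StrictMonoOn (fun z => F z - phi x * z ^ s / s) (Set.Icc y x) := by
      apply strictMonoOn_of_deriv_pos (convex_Icc y x)
      · exact fun z hz => (hd _ z (hpos z hz)).continuousAt.continuousWithinAt
      · intro z hz
        rw [interior_Icc] at hz
        have hz0 : 0 < z := hy.trans hz.1
        rw [(hd _ z hz0).deriv]
        have := phi_anti (Set.mem_Ioi.2 hz0) (Set.mem_Ioi.2 (hy.trans hxy)) hz.2
        exact mul_pos (Real.rpow_pos_of_pos hz0 _) (by linarith)
    have := hm (Set.left_mem_Icc.2 hxy.le) (Set.right_mem_Icc.2 hxy.le) hxy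
    simp only at this
    rw [mul_sub, sub_div]
    linarith
  · have hm : StrictAntiOn (fun z => F z - phi y * z ^ s / s) (Set.Icc y x) := by
      apply strictAntiOn_of_deriv_neg (convex_Icc y x)
      · exact fun z hz => (hd _ z (hpos z hz)).continuousAt.continuousWithinAt
      · intro z hz
        rw [interior_Icc] at hz
        have hz0 : 0 < z := hy.trans hz.1
        rw [(hd _ z hz0).deriv]
        have := phi_anti (Set.mem_Ioi.2 hy) (Set.mem_Ioi.2 hz0) hz.1
        exact mul_neg_of_pos_of_neg (Real.rpow_pos_of_pos hz0 _) (by linarith)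
    have := hm (Set.left_mem_Icc.2 hxy.le) (Set.right_mem_Icc.2 hxy.le) hxy
    simp only at this
    rw [mul_sub, sub_div]
    linarith

open Filter Topology in
lemma hasSum_tele {u : ℤ → ℝ} {M : ℝ} (hu : ∀ j, 0 ≤ u j - u (j + 1))
    (h0 : Tendsto (fun n : ℕ => u n) atTop (𝓝 0))
    (hM : Tendsto (fun n : ℕ => u (-(n : ℤ))) atTop (𝓝 M)) :
    HasSum (fun j => u j - u (j + 1)) M := by
  have h1 : HasSum (fun n : ℕ => u n - u (n + 1)) (u 0) := by
    rw [hasSum_iff_tendsto_nat_of_nonneg (fun n => hu n)]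
    have e : ∀ n : ℕ, ∑ i ∈ Finset.range n, (u i - u (i + 1)) = u 0 - u n := by
      intro n
      have := Finset.sum_range_sub' (fun n : ℕ => u n) n
      simpa using this
    simp_rw [e]
    simpa using h0.const_sub (u 0)
  have h2 : HasSum (fun n : ℕ => u (-((n : ℤ) + 1)) - u (-((n : ℤ) + 1) + 1)) (M - u 0) := by
    rw [hasSum_iff_tendsto_nat_of_nonneg (fun n => hu _)]
    have e : ∀ n : ℕ, ∑ i ∈ Finset.range n, (u (-((i : ℤ) + 1)) - u (-((i : ℤ) + 1) + 1))
        = u (-(n : ℤ)) - u 0 := by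
      intro n
      have := Finset.sum_range_sub (fun n : ℕ => u (-(n : ℤ))) n
      simp at this
      simpa using this
    simp_rw [e]
    exact hM.sub_const _
  have := HasSum.of_nat_of_neg_add_one (f := fun j => u j - u (j + 1)) h1 h2
  simpa using this

open Filter Topology in
lemma main_aux {a c s : ℝ} (ha0 : 0 < a) (ha1 : a < 1) (hc : 0 < c) (hs : 0 < s) (hs1 : s < 1) :
    ∃ S : ℝ, HasSum (fun j : ℤ => (c * a ^ j) ^ s * phi (c * a ^ j)) S ∧ 0 < S ∧
      S * ((1 - a ^ s) / s) < Real.Gamma s / ((1 - s) * (2 - s) * (3 - s)) ∧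
      Real.Gamma s / ((1 - s) * (2 - s) * (3 - s)) < S * ((a ^ (-s) - 1) / s) := by
  obtain ⟨F, hF, hF0, hFt⟩ := exists_F hs hs1
  set M := Real.Gamma s / ((1 - s) * (2 - s) * (3 - s))
  have hx : ∀ j : ℤ, 0 < c * a ^ j := fun j => by positivity
  have hstep : ∀ j : ℤ, c * a ^ (j + 1) = a * (c * a ^ j) := fun j => by
    rw [zpow_add_one₀ ha0.ne']; ring
  have has : 0 < a ^ s := Real.rpow_pos_of_pos ha0 s
  have has1 : a ^ s < 1 := Real.rpow_lt_one ha0.le ha1 hs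
  set T : ℤ → ℝ := fun j => (c * a ^ j) ^ s * phi (c * a ^ j) with hT
  set u : ℤ → ℝ := fun j => F (c * a ^ j) with hu
  have hTpos : ∀ j, 0 < T j := fun j => mul_pos (Real.rpow_pos_of_pos (hx j) _) (phi_pos (hx j))
  have hb : ∀ j, T j * ((1 - a ^ s) / s) < u j - u (j + 1) ∧
      u j - u (j + 1) < T (j + 1) * ((a ^ (-s) - 1) / s) := by
    intro j
    have hlt : c * a ^ (j + 1) < c * a ^ j := by
      rw [hstep]; nlinarith [hx j]
    have h := F_bounds hs hF (hx (j + 1)) hlt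
    have e : (c * a ^ (j + 1)) ^ s = a ^ s * (c * a ^ j) ^ s := by
      rw [hstep, Real.mul_rpow ha0.le (hx j).le]
    refine ⟨lt_of_eq_of_lt ?_ h.1, lt_of_lt_of_eq h.2 ?_⟩
    · rw [e]; simp only [hT]; ring
    · simp only [hT]; rw [e, Real.rpow_neg ha0.le]; field_simp
  have hq : 0 < (1 - a ^ s) / s := div_pos (by linarith) hs
  have hsum : HasSum (fun j => u j - u (j + 1)) M := by
    apply hasSum_tele
    · intro j
      exact (lt_trans (mul_pos (hTpos j) hq) (hb j).1).le
    · refine hF0.comp (tendsto_nhdsWithin_iff.2 ⟨?_, Eventually.of_forall fun n => hx n⟩)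
      have := (tendsto_pow_atTop_nhds_zero_of_lt_one ha0.le ha1).const_mul c
      simpa using this
    · refine hFt.comp ?_
      have h1 : 1 < a⁻¹ := (one_lt_inv₀ ha0).2 ha1
      have := (tendsto_pow_atTop_atTop_of_one_lt h1).const_mul_atTop hc
      simpa using this
  have hTs : Summable T := by
    have : Summable (fun j => T j * ((1 - a ^ s) / s)) :=
      Summable.of_nonneg_of_le (fun j => (mul_pos (hTpos j) hq).le) (fun j => (hb j).1.le)
        hsum.summable
    exact (summable_mul_right_iff hq.ne').1 this
  refine ⟨∑' j, T j, hTs.hasSum, hTs.tsum_pos (fun j => (hTpos j).le) 0 (hTpos 0), ?_, ?_⟩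
  · exact hasSum_lt (fun j => (hb j).1.le) (hb 0).1 (hTs.hasSum.mul_right _) hsum
  · have hsh : HasSum (fun j => T (j + 1)) (∑' j, T j) :=
      (Equiv.addRight (1 : ℤ)).hasSum_iff.2 hTs.hasSum
    exact hasSum_lt (fun j => (hb j).2.le) (hb 0).2 hsum (hsh.mul_right _)

theorem stmt1 (a b : ℝ) (ha0 : 0 < a) (ha1 : a < 1) (hb : 0 < b)
    (H : ℝ) (hH1 : 1 < H) (hH2 : H < 3 / 2) (t : ℝ) (ht : 0 < t) :
    Summable (fun j : ℤ => (b * a ^ j * t) ^ (-(2 * H)) *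
      (Real.exp (-(b * a ^ j * t)) - 1 + b * a ^ j * t - (b * a ^ j * t) ^ 2 / 2)) ∧
    htil a b H t < 0 ∧
    Real.Gamma (4 - 2 * H) / (2 * H * (2 * H - 1) * (2 * H - 2) * (a ^ (2 * H - 3) - 1))
      < |htil a b H t| ∧
    |htil a b H t| < a ^ (2 * H - 3) *
      (Real.Gamma (4 - 2 * H) / (2 * H * (2 * H - 1) * (2 * H - 2) * (a ^ (2 * H - 3) - 1))) ∧
    htil a b H (a * t) = htil a b H t := by
  obtain ⟨s, rfl⟩ : ∃ s, H = (3 - s) / 2 := ⟨3 - 2 * H, by ring⟩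
  have hs : 0 < s := by linarith
  have hs1 : s < 1 := by linarith
  obtain ⟨S, hS, hS0, hlo, hhi⟩ := main_aux (c := b * t) ha0 ha1 (by positivity) hs hs1
  have hterm : (fun j : ℤ => (b * a ^ j * t) ^ (-(2 * ((3 - s) / 2))) *
      (Real.exp (-(b * a ^ j * t)) - 1 + b * a ^ j * t - (b * a ^ j * t) ^ 2 / 2)) =
      fun j : ℤ => -((b * t * a ^ j) ^ s * phi (b * t * a ^ j)) := by
    funext j
    have e : b * a ^ j * t = b * t * a ^ j := by ring
    rw [e]
    have hx : 0 < b * t * a ^ j := by positivity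
    set x := b * t * a ^ j
    have e2 : -(2 * ((3 - s) / 2)) = s - (3 : ℕ) := by push_cast; ring
    rw [e2, Real.rpow_sub_natCast hx.ne']
    unfold phi gf
    field_simp
    ring
  have hval : htil a b ((3 - s) / 2) t = -S := by
    unfold htil
    rw [hterm]
    exact hS.neg.tsum_eq
  have hG : Real.Gamma (4 - 2 * ((3 - s) / 2)) = s * Real.Gamma s := by
    rw [← Real.Gamma_add_one hs.ne']; congr 1; ring
  have hp : 2 * ((3 - s) / 2) - 3 = -s := by ring
  have has : 0 < a ^ s := Real.rpow_pos_of_pos ha0 s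
  have has1 : a ^ s < 1 := Real.rpow_lt_one ha0.le ha1 hs
  have hinv : a ^ (-s) = (a ^ s)⁻¹ := Real.rpow_neg ha0.le s
  have hA : 0 < a ^ (-s) - 1 := by
    rw [hinv, sub_pos]; exact (one_lt_inv₀ has).2 has1
  have hC : Real.Gamma (4 - 2 * ((3 - s) / 2)) / (2 * ((3 - s) / 2) * (2 * ((3 - s) / 2) - 1) *
      (2 * ((3 - s) / 2) - 2) * (a ^ (2 * ((3 - s) / 2) - 3) - 1)) =
      Real.Gamma s / ((1 - s) * (2 - s) * (3 - s)) / ((a ^ (-s) - 1) / s) := by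
    rw [hG, hp]
    have d1 : 2 * ((3 - s) / 2) = 3 - s := by ring
    have d2 : 3 - s - 1 = 2 - s := by ring
    have d3 : 3 - s - 2 = 1 - s := by ring
    rw [d1, d2, d3]
    have e1 : (1 - s) ≠ 0 := by linarith
    have e2 : (2 - s) ≠ 0 := by linarith
    have e3 : (3 - s) ≠ 0 := by linarith
    have e4 := hA.ne'
    field_simp
  rw [hC, hp, hval, abs_neg, abs_of_pos hS0]
  refine ⟨?_, by linarith, ?_, ?_, ?_⟩
  · rw [hterm]; exact hS.neg.summable
  · rw [div_lt_iff₀ (div_pos hA hs)]; exact hhi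
  · have e : a ^ (-s) * (Real.Gamma s / ((1 - s) * (2 - s) * (3 - s)) / ((a ^ (-s) - 1) / s)) =
        Real.Gamma s / ((1 - s) * (2 - s) * (3 - s)) / ((1 - a ^ s) / s) := by
      have h1 : (1 - a ^ s) / s = a ^ s * ((a ^ (-s) - 1) / s) := by
        rw [hinv]; field_simp
      rw [h1, hinv]
      rw [hinv] at hA
      have := hA.ne'
      field_simp
    rw [e, lt_div_iff₀ (div_pos (by linarith) hs)]
    exact hlo
  · rw [← hval]
    unfold htil
    rw [← (Equiv.addRight (1 : ℤ)).tsum_eq (fun j : ℤ => (b * a ^ j * t) ^ (-(2 * ((3 - s) / 2))) *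
      (Real.exp (-(b * a ^ j * t)) - 1 + b * a ^ j * t - (b * a ^ j * t) ^ 2 / 2))]
    refine tsum_congr fun j => ?_
    have e : b * a ^ j * (a * t) = b * a ^ (j + 1) * t := by
      rw [zpow_add_one₀ ha0.ne']; ring
    rw [e]
    rfl
end

section
/- For every real γ > -1 there exist constants 0 < C₁ ≤ C₂ < ∞ (depending on a, b, γ) such that for all t > 0, C₁ ≤ Σ_{j∈ℤ} (b a^j t)^{γ+1} e^{-b a^j t} ≤ C₂; in particular the series converges for every t > 0. -/
open Real

lemma aux_bd (p x : ℝ) (hp : 0 < p) (hx : 0 < x) : x ^ p * Real.exp (-x) ≤ p ^ p := by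
  have h1 : x ≤ p * Real.exp (x / p) := by
    have h := Real.add_one_le_exp (x / p)
    have h2 : x = p * (x / p) := by field_simp
    have h3 : p * (x / p) ≤ p * Real.exp (x / p) :=
      mul_le_mul_of_nonneg_left (by linarith) hp.le
    linarith
  have h2 : x ^ p ≤ (p * Real.exp (x / p)) ^ p := Real.rpow_le_rpow hx.le h1 hp.le
  rw [Real.mul_rpow hp.le (Real.exp_pos _).le, ← Real.exp_mul, div_mul_cancel₀ _ hp.ne'] at h2
  rw [Real.exp_neg, ← div_eq_mul_inv, div_le_iff₀ (Real.exp_pos x)]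
  exact h2

lemma aux_term (a s u : ℝ) (ha0 : 0 < a) (hs : 0 < s) (hu1 : a ≤ u) (hu2 : u ≤ 1)
    (j : ℤ) : (u * a ^ j) ^ s * Real.exp (-(u * a ^ j)) ≤
      max 1 ((2 * s) ^ (2 * s) * (a ^ s)⁻¹) * (a ^ s) ^ j.natAbs := by
  have hu : 0 < u := ha0.trans_le hu1
  have hx : 0 < u * a ^ j := mul_pos hu (zpow_pos ha0 j)
  have hr : 0 < a ^ s := Real.rpow_pos_of_pos ha0 s
  obtain ⟨k, rfl | rfl⟩ := j.eq_nat_or_neg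
  · have e1 : (u * a ^ (k : ℤ)) ^ s ≤ (a ^ s) ^ k := by
      rw [zpow_natCast, ← Real.rpow_natCast (a ^ s), ← Real.rpow_mul ha0.le, mul_comm s,
        Real.rpow_mul ha0.le, Real.rpow_natCast]
      apply Real.rpow_le_rpow (by positivity) _ hs.le
      exact mul_le_of_le_one_left (by positivity) hu2
    have e2 : Real.exp (-(u * a ^ (k : ℤ))) ≤ 1 := Real.exp_le_one_iff.2 (by linarith)
    simp only [Int.natAbs_natCast]
    calc _ ≤ (a ^ s) ^ k * 1 := mul_le_mul e1 e2 (Real.exp_pos _).le (by positivity)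
      _ = 1 * (a ^ s) ^ k := by ring
      _ ≤ _ := mul_le_mul_of_nonneg_right (le_max_left _ _) (by positivity)
  · have e0 := aux_bd (2 * s) _ (by positivity) hx
    simp only [Int.natAbs_neg, Int.natAbs_natCast]
    set x := u * a ^ (-(k : ℤ)) with hxd
    have e3 : a ^ s * ((a ^ s) ^ k)⁻¹ ≤ x ^ s := by
      have : a ^ s * ((a ^ s) ^ k)⁻¹ = (a * a ^ (-(k : ℤ))) ^ s := by
        rw [Real.mul_rpow ha0.le (by positivity), zpow_neg, zpow_natCast,
          Real.inv_rpow (by positivity), ← Real.rpow_natCast (a ^ s), ← Real.rpow_mul ha0.le,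
          mul_comm s, Real.rpow_mul ha0.le, Real.rpow_natCast]
      rw [this]
      apply Real.rpow_le_rpow (by positivity) _ hs.le
      exact mul_le_mul_of_nonneg_right hu1 (by positivity)
    have hxs : 0 < x ^ s := Real.rpow_pos_of_pos hx s
    have e4 : x ^ (2 * s) = x ^ s * x ^ s := by rw [← Real.rpow_add hx]; ring_nf
    rw [e4] at e0
    have e5 : (a ^ s * ((a ^ s) ^ k)⁻¹) * (x ^ s * Real.exp (-x)) ≤ (2 * s) ^ (2 * s) := by
      refine le_trans (mul_le_mul_of_nonneg_right e3 (by positivity)) ?_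
      linarith
    calc x ^ s * Real.exp (-x)
        = ((a ^ s * ((a ^ s) ^ k)⁻¹) * (x ^ s * Real.exp (-x))) * ((a ^ s)⁻¹ * (a ^ s) ^ k) := by
          field_simp
      _ ≤ (2 * s) ^ (2 * s) * ((a ^ s)⁻¹ * (a ^ s) ^ k) :=
          mul_le_mul_of_nonneg_right e5 (by positivity)
      _ = ((2 * s) ^ (2 * s) * (a ^ s)⁻¹) * (a ^ s) ^ k := by ring
      _ ≤ _ := mul_le_mul_of_nonneg_right (le_max_right _ _) (by positivity)

theorem stmt2 (a b : ℝ) (ha0 : 0 < a) (ha1 : a < 1) (hb : 0 < b)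
    (γ : ℝ) (hγ : -1 < γ) :
    ∃ C₁ C₂ : ℝ, 0 < C₁ ∧ C₁ ≤ C₂ ∧ ∀ t : ℝ, 0 < t →
      Summable (fun j : ℤ => (b * a ^ j * t) ^ (γ + 1) * Real.exp (-(b * a ^ j * t))) ∧
      C₁ ≤ ∑' j : ℤ, (b * a ^ j * t) ^ (γ + 1) * Real.exp (-(b * a ^ j * t)) ∧
      (∑' j : ℤ, (b * a ^ j * t) ^ (γ + 1) * Real.exp (-(b * a ^ j * t))) ≤ C₂ := by
  have hs : 0 < γ + 1 := by linarith
  generalize γ + 1 = s at hs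
  have hr : 0 < a ^ s := Real.rpow_pos_of_pos ha0 s
  have hr1 : a ^ s < 1 := Real.rpow_lt_one ha0.le ha1 hs
  set K := max 1 ((2 * s) ^ (2 * s) * (a ^ s)⁻¹) with hK
  have hg : Summable (fun j : ℤ => K * (a ^ s) ^ j.natAbs) := by
    apply Summable.mul_left
    have := summable_geometric_of_lt_one hr.le hr1
    apply Summable.of_nat_of_neg <;> simpa using this
  refine ⟨a ^ s * Real.exp (-1), max (a ^ s * Real.exp (-1)) (∑' j : ℤ, K * (a ^ s) ^ j.natAbs),
    by positivity, le_max_left _ _, fun t ht => ?_⟩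
  obtain ⟨n, hn1, hn2⟩ := exists_mem_Ioc_zpow (mul_pos hb ht) ((one_lt_inv₀ ha0).2 ha1)
  have hterm : ∀ j : ℤ, b * a ^ j * t = (b * t * a ^ (n + 1)) * a ^ (j - (n + 1)) := by
    intro j
    rw [mul_assoc (b * t), ← zpow_add₀ ha0.ne']
    ring_nf
  have hp : 0 < a ^ (n + 1) := zpow_pos ha0 _
  have hu1 : a ≤ b * t * a ^ (n + 1) := by
    have h := mul_le_mul_of_nonneg_right hn1.le hp.le
    rw [inv_zpow, zpow_add_one₀ ha0.ne', inv_mul_cancel_left₀ (zpow_pos ha0 n).ne'] at h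
    rwa [zpow_add_one₀ ha0.ne']
  have hu2 : b * t * a ^ (n + 1) ≤ 1 := by
    have h := mul_le_mul_of_nonneg_right hn2 hp.le
    rwa [inv_zpow, inv_mul_cancel₀ hp.ne'] at h
  set u := b * t * a ^ (n + 1) with hu
  have hu0 : 0 < u := ha0.trans_le hu1
  set F : ℤ → ℝ := fun j => (u * a ^ j) ^ s * Real.exp (-(u * a ^ j)) with hF
  have hF0 : ∀ j, 0 ≤ F j := fun j => by
    have := zpow_pos ha0 j
    simp only [hF]; positivity
  have hFle : ∀ j, F j ≤ K * (a ^ s) ^ j.natAbs := aux_term a s u ha0 hs hu1 hu2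
  have hFs : Summable F := Summable.of_nonneg_of_le hF0 hFle hg
  have heq : (fun j : ℤ => (b * a ^ j * t) ^ s * Real.exp (-(b * a ^ j * t)))
      = F ∘ (Equiv.subRight (n + 1)) := by
    funext j
    simp only [hF, Function.comp, Equiv.subRight_apply, hterm j]
  have hsum : (∑' j : ℤ, (b * a ^ j * t) ^ s * Real.exp (-(b * a ^ j * t))) = ∑' j, F j := by
    rw [heq]; exact (Equiv.subRight (n + 1)).tsum_eq F
  rw [hsum]
  refine ⟨?_, ?_, ?_⟩
  · rw [heq]; exact (Equiv.subRight (n + 1)).summable_iff.2 hFs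
  · refine le_trans ?_ (hFs.le_tsum 0 (fun j _ => hF0 j))
    simp only [hF, zpow_zero, mul_one]
    exact mul_le_mul (Real.rpow_le_rpow ha0.le hu1 hs.le) (Real.exp_le_exp.2 (by linarith))
      (Real.exp_pos _).le (by positivity)
  · exact le_trans (hFs.tsum_le_tsum hFle hg) (le_max_right _ _)
end

section
/- For every H in (1/2, 1) and all s, t > 0, Σ_{j∈ℤ} (b a^j)^{-2H} (1 - e^{-b a^j s})(1 - e^{-b a^j t}) = (s+t)^{2H} h_{s+t} - s^{2H} h_s - t^{2H} h_t. (In particular the right-hand side, which is the covariance of the oscillatory process η^H, is a positive semidefinite kernel.) -/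
open Real

lemma phi_nonneg (y : ℝ) : 0 ≤ Real.exp (-y) - 1 + y := by
  have := Real.add_one_le_exp (-y)
  linarith

lemma phi_le (y : ℝ) (hy : 0 ≤ y) : Real.exp (-y) - 1 + y ≤ y := by
  have : Real.exp (-y) ≤ 1 := Real.exp_le_one_iff.2 (by linarith)
  linarith

lemma phi_le_sq (y : ℝ) (hy : 0 ≤ y) : Real.exp (-y) - 1 + y ≤ y ^ 2 := by
  rcases le_total y 1 with h | h
  · have h1 := Real.abs_exp_sub_one_sub_id_le (x := -y) (by rw [abs_neg, abs_of_nonneg hy]; exact h)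
    have h2 := (abs_le.1 h1).2
    nlinarith
  · have := phi_le y hy
    nlinarith

/-- rescaled summand -/
noncomputable def gterm (a b H t : ℝ) (j : ℤ) : ℝ :=
  (b * a ^ j) ^ (-(2 * H)) * (Real.exp (-(b * a ^ j * t)) - 1 + b * a ^ j * t)

lemma gterm_summable (a b : ℝ) (ha0 : 0 < a) (ha1 : a < 1) (hb : 0 < b)
    (H : ℝ) (hH1 : 1 / 2 < H) (hH2 : H < 1) (t : ℝ) (ht : 0 ≤ t) :
    Summable (gterm a b H t) := by
  apply Summable.of_nat_of_neg
  · have hg : Summable (fun n : ℕ => (t ^ 2 * b ^ (2 - 2 * H)) * (a ^ (2 - 2 * H)) ^ n) := by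
      apply Summable.mul_left
      exact summable_geometric_of_lt_one (by positivity)
        (Real.rpow_lt_one ha0.le ha1 (by linarith))
    refine Summable.of_nonneg_of_le (fun n => ?_) (fun n => ?_) hg
    · exact mul_nonneg (by positivity) (phi_nonneg _)
    · have hx : 0 < b * a ^ (n : ℤ) := by positivity
      have e : (t ^ 2 * b ^ (2 - 2 * H)) * (a ^ (2 - 2 * H)) ^ n
          = (b * a ^ (n : ℤ)) ^ (-(2 * H)) * (b * a ^ (n : ℤ) * t) ^ 2 := by
        have h1 : (a ^ (2 - 2 * H)) ^ n = (a ^ (n : ℤ)) ^ (2 - 2 * H) := by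
          rw [zpow_natCast, ← Real.rpow_natCast, ← Real.rpow_natCast, ← Real.rpow_mul ha0.le,
            ← Real.rpow_mul ha0.le, mul_comm]
        rw [h1, mul_assoc, ← Real.mul_rpow hb.le (by positivity),
          show (2 - 2 * H) = -(2 * H) + (2 : ℕ) by push_cast; ring, Real.rpow_add hx,
          Real.rpow_natCast]
        ring
      rw [e]
      exact mul_le_mul_of_nonneg_left (phi_le_sq _ (by positivity)) (by positivity)
  · have hg : Summable (fun n : ℕ => (t * b ^ (1 - 2 * H)) * (a ^ (2 * H - 1)) ^ n) := by
      apply Summable.mul_left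
      exact summable_geometric_of_lt_one (by positivity)
        (Real.rpow_lt_one ha0.le ha1 (by linarith))
    refine Summable.of_nonneg_of_le (fun n => ?_) (fun n => ?_) hg
    · exact mul_nonneg (by positivity) (phi_nonneg _)
    · have hx : 0 < b * a ^ (-(n : ℤ)) := by positivity
      have e : (t * b ^ (1 - 2 * H)) * (a ^ (2 * H - 1)) ^ n
          = (b * a ^ (-(n : ℤ))) ^ (-(2 * H)) * (b * a ^ (-(n : ℤ)) * t) := by
        have h1 : (a ^ (2 * H - 1)) ^ n = (a ^ (-(n : ℤ))) ^ (1 - 2 * H) := by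
          rw [zpow_neg, zpow_natCast, ← Real.rpow_natCast, ← Real.rpow_natCast,
            ← Real.rpow_neg ha0.le, ← Real.rpow_mul ha0.le, ← Real.rpow_mul ha0.le]
          congr 1; ring
        rw [h1, mul_assoc, ← Real.mul_rpow hb.le (by positivity),
          show (1 - 2 * H) = -(2 * H) + 1 by ring, Real.rpow_add hx, Real.rpow_one]
        ring
      rw [e]
      exact mul_le_mul_of_nonneg_left (phi_le _ (by positivity)) (by positivity)

lemma gterm_hasSum (a b : ℝ) (ha0 : 0 < a) (ha1 : a < 1) (hb : 0 < b)
    (H : ℝ) (hH1 : 1 / 2 < H) (hH2 : H < 1) (t : ℝ) (ht : 0 ≤ t) :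
    HasSum (gterm a b H t) (t ^ (2 * H) * hosc a b H t) := by
  have hs := (gterm_summable a b ha0 ha1 hb H hH1 hH2 t ht).hasSum
  convert hs using 1
  rcases ht.eq_or_lt with h | h
  · subst h
    rw [Real.zero_rpow (by linarith)]
    simp [gterm]
  · rw [hosc, ← tsum_mul_left]
    congr 1
    ext j
    have hx : 0 < b * a ^ j := by positivity
    rw [gterm, Real.mul_rpow hx.le h.le, Real.rpow_neg h.le]
    have : t ^ (2 * H) ≠ 0 := by positivity
    field_simp

lemma kernel_hasSum (a b : ℝ) (ha0 : 0 < a) (ha1 : a < 1) (hb : 0 < b)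
    (H : ℝ) (hH1 : 1 / 2 < H) (hH2 : H < 1) (s t : ℝ) (hs : 0 ≤ s) (ht : 0 ≤ t) :
    HasSum (fun j : ℤ => (b * a ^ j) ^ (-(2 * H)) *
        ((1 - Real.exp (-(b * a ^ j * s))) * (1 - Real.exp (-(b * a ^ j * t)))))
      ((s + t) ^ (2 * H) * hosc a b H (s + t)
        - s ^ (2 * H) * hosc a b H s - t ^ (2 * H) * hosc a b H t) := by
  have h := ((gterm_hasSum a b ha0 ha1 hb H hH1 hH2 (s + t) (by linarith)).sub
    (gterm_hasSum a b ha0 ha1 hb H hH1 hH2 s hs)).sub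
    (gterm_hasSum a b ha0 ha1 hb H hH1 hH2 t ht)
  refine Eq.subst (motive := fun f => HasSum f _) ?_ h
  funext j
  simp only [gterm]
  rw [show -(b * a ^ j * (s + t)) = -(b * a ^ j * s) + -(b * a ^ j * t) by ring, Real.exp_add]
  ring

theorem stmt3 (a b : ℝ) (ha0 : 0 < a) (ha1 : a < 1) (hb : 0 < b)
    (H : ℝ) (hH1 : 1 / 2 < H) (hH2 : H < 1) :
    (∀ s t : ℝ, 0 < s → 0 < t →
      (∑' j : ℤ, (b * a ^ j) ^ (-(2 * H)) *
        ((1 - Real.exp (-(b * a ^ j * s))) * (1 - Real.exp (-(b * a ^ j * t)))))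
      = (s + t) ^ (2 * H) * hosc a b H (s + t)
        - s ^ (2 * H) * hosc a b H s - t ^ (2 * H) * hosc a b H t) ∧
    (∀ (n : ℕ) (t c : Fin n → ℝ), (∀ i, 0 ≤ t i) →
      0 ≤ ∑ i, ∑ k, c i * c k *
        ((t i + t k) ^ (2 * H) * hosc a b H (t i + t k)
          - (t i) ^ (2 * H) * hosc a b H (t i)
          - (t k) ^ (2 * H) * hosc a b H (t k))) := by
  refine ⟨fun s t hs ht =>
    (kernel_hasSum a b ha0 ha1 hb H hH1 hH2 s t hs.le ht.le).tsum_eq, fun n t c ht => ?_⟩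
  have h := hasSum_sum (s := Finset.univ) (fun i (_ : i ∈ Finset.univ) =>
    hasSum_sum (s := Finset.univ) (fun k (_ : k ∈ Finset.univ) =>
      (kernel_hasSum a b ha0 ha1 hb H hH1 hH2 (t i) (t k) (ht i) (ht k)).mul_left (c i * c k)))
  refine h.nonneg (fun j => ?_)
  have e : ∑ i, ∑ k, c i * c k * ((b * a ^ j) ^ (-(2 * H)) *
        ((1 - Real.exp (-(b * a ^ j * t i))) * (1 - Real.exp (-(b * a ^ j * t k)))))
      = (b * a ^ j) ^ (-(2 * H)) * (∑ i, c i * (1 - Real.exp (-(b * a ^ j * t i)))) ^ 2 := by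
    rw [sq, Finset.sum_mul_sum, Finset.mul_sum]
    refine Finset.sum_congr rfl (fun i _ => ?_)
    rw [Finset.mul_sum]
    refine Finset.sum_congr rfl (fun k _ => ?_)
    ring
  rw [e]
  positivity
end

section
/- For every H in (1, 3/2) and all s, t ≥ 0, the unified triple-integral form of the oscillatory negative sub-fractional Brownian motion covariance holds: ∫_0^t ∫_0^s ∫_0^{u∧v} Σ_{j∈ℤ} e^{-b a^j (u+v-2r)} (b a^j)^{3-2H} dr du dv = Q̃_H(s,t), where Q̃_H(s,t) = s^{2H} h̃_s + t^{2H} h̃_t - (1/2)[(s+t)^{2H} h̃_{s+t} + |s-t|^{2H} h̃_{|s-t|}]. -/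
open Real

/-- The oscillatory negative sub-fractional Brownian motion covariance `Q̃_H(s,t)`. -/
noncomputable def Qtil (a b H s t : ℝ) : ℝ :=
  s ^ (2 * H) * htil a b H s + t ^ (2 * H) * htil a b H t
    - (1 / 2) * ((s + t) ^ (2 * H) * htil a b H (s + t)
      + |s - t| ^ (2 * H) * htil a b H |s - t|)

open MeasureTheory

/-- Basic majorant used for all interchanges of sum and integral. -/
theorem summable_major (a b : ℝ) (ha0 : 0 < a) (ha1 : a < 1) (hb : 0 < b)
    (H : ℝ) (hH1 : 1 < H) (hH2 : H < 3 / 2) (K : ℝ) (hK : 0 ≤ K) :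
    Summable (fun j : ℤ => (b * a ^ j) ^ (2 - 2 * H) * min 1 (K * (b * a ^ j))) := by
  apply Summable.of_nat_of_neg
  · refine Summable.of_nonneg_of_le (fun n => by positivity) (fun n => ?_)
      ((summable_geometric_of_lt_one (r := a ^ (3 - 2 * H)) (by positivity)
        (Real.rpow_lt_one ha0.le ha1 (by linarith))).mul_left (K * b ^ (3 - 2 * H)))
    have hc : 0 < b * a ^ n := by positivity
    have e1 : (b * a ^ n) ^ (3 - 2 * H) = (b * a ^ n) ^ (2 - 2 * H) * (b * a ^ n) := by
      rw [← Real.rpow_add_one hc.ne']; congr 1; ring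
    have e2 : (b * a ^ n) ^ (3 - 2 * H) = b ^ (3 - 2 * H) * (a ^ (3 - 2 * H)) ^ n := by
      rw [Real.mul_rpow hb.le (by positivity), ← Real.rpow_natCast, ← Real.rpow_natCast,
        ← Real.rpow_mul ha0.le, ← Real.rpow_mul ha0.le, mul_comm (n : ℝ)]
    simp only [zpow_natCast]
    calc _ ≤ (b * a ^ n) ^ (2 - 2 * H) * (K * (b * a ^ n)) := by
          gcongr; exact min_le_right _ _
      _ = K * (b * a ^ n) ^ (3 - 2 * H) := by rw [e1]; ring
      _ = _ := by rw [e2]; ring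
  · refine Summable.of_nonneg_of_le (fun n => by positivity) (fun n => ?_)
      ((summable_geometric_of_lt_one (r := a ^ (2 * H - 2)) (by positivity)
        (Real.rpow_lt_one ha0.le ha1 (by linarith))).mul_left (b ^ (2 - 2 * H)))
    have e2 : (b * a ^ (-(n : ℤ))) ^ (2 - 2 * H) = b ^ (2 - 2 * H) * (a ^ (2 * H - 2)) ^ n := by
      rw [Real.mul_rpow hb.le (by positivity), ← Real.rpow_natCast, ← Real.rpow_intCast,
        ← Real.rpow_mul ha0.le, ← Real.rpow_mul ha0.le]
      congr 2; push_cast; ring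
    calc _ ≤ (b * a ^ (-(n : ℤ))) ^ (2 - 2 * H) * 1 := by
          gcongr; exact min_le_left _ _
      _ = _ := by rw [e2, mul_one]

theorem g_bound (y : ℝ) (hy : 0 ≤ y) :
    |Real.exp (-y) - 1 + y - y ^ 2 / 2| ≤ y ^ 2 * min 1 y := by
  have h0 : 1 - y ≤ Real.exp (-y) := by have := Real.add_one_le_exp (-y); linarith
  rcases le_total y 1 with h | h
  · rw [min_eq_right h]
    have := Real.exp_bound (x := -y) (by rw [abs_neg, abs_of_nonneg hy]; exact h)
      (n := 3) (by norm_num)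
    rw [abs_neg, abs_of_nonneg hy] at this
    simp [Finset.sum_range_succ, Nat.factorial] at this
    have h3 : 0 ≤ y ^ 3 := by positivity
    rw [abs_le] at this ⊢
    constructor <;> nlinarith
  · rw [min_eq_left h]
    have h1 : Real.exp (-y) ≤ 1 := Real.exp_le_one_iff.2 (by linarith)
    rw [abs_le]
    constructor <;> nlinarith

theorem summable_g (a b : ℝ) (ha0 : 0 < a) (ha1 : a < 1) (hb : 0 < b)
    (H : ℝ) (hH1 : 1 < H) (hH2 : H < 3 / 2) (x : ℝ) (hx : 0 ≤ x) :
    Summable (fun j : ℤ => (b * a ^ j) ^ (-(2 * H)) *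
      (Real.exp (-(b * a ^ j * x)) - 1 + b * a ^ j * x - (b * a ^ j * x) ^ 2 / 2)) := by
  refine Summable.of_norm_bounded
    ((summable_major a b ha0 ha1 hb H hH1 hH2 x hx).mul_left (x ^ 2)) (fun j => ?_)
  have hc : 0 < b * a ^ j := by positivity
  have e1 : (b * a ^ j) ^ (2 - 2 * H) = (b * a ^ j) ^ (-(2 * H)) * (b * a ^ j) ^ 2 := by
    rw [← Real.rpow_natCast (b * a ^ j) 2, ← Real.rpow_add hc]; congr 1; push_cast; ring
  rw [norm_mul, Real.norm_of_nonneg (by positivity), Real.norm_eq_abs, e1]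
  calc _ ≤ (b * a ^ j) ^ (-(2 * H)) * ((b * a ^ j * x) ^ 2 * min 1 (b * a ^ j * x)) := by
        gcongr; exact g_bound _ (by positivity)
    _ = _ := by rw [mul_comm x (b * a ^ j)]; ring

theorem htil_eq (a b : ℝ) (ha0 : 0 < a) (hb : 0 < b)
    (H : ℝ) (hH1 : 1 < H) (x : ℝ) (hx : 0 ≤ x) :
    x ^ (2 * H) * htil a b H x = ∑' j : ℤ, (b * a ^ j) ^ (-(2 * H)) *
      (Real.exp (-(b * a ^ j * x)) - 1 + b * a ^ j * x - (b * a ^ j * x) ^ 2 / 2) := by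
  rcases hx.eq_or_lt with rfl | hx
  · rw [Real.zero_rpow (by linarith)]; simp
  · rw [htil, ← tsum_mul_left]
    congr 1; ext j
    have hc : 0 < b * a ^ j := by positivity
    rw [Real.mul_rpow hc.le hx.le, Real.rpow_neg hx.le]
    have : x ^ (2 * H) ≠ 0 := by positivity
    field_simp

theorem inner_r (c u v : ℝ) (hc : 0 < c) (H : ℝ) :
    ∫ r in (0:ℝ)..(min u v), Real.exp (-(c * (u + v - 2 * r))) * c ^ (3 - 2 * H)
      = c ^ (2 - 2 * H) / 2 * (Real.exp (-(c * |u - v|)) - Real.exp (-(c * (u + v)))) := by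
  have hd : ∀ r ∈ Set.uIcc 0 (min u v), HasDerivAt
      (fun r => Real.exp (-(c * (u + v - 2 * r))) * (c ^ (2 - 2 * H) / 2))
      (Real.exp (-(c * (u + v - 2 * r))) * c ^ (3 - 2 * H)) r := by
    intro r _
    have h1 : HasDerivAt (fun r : ℝ => -(c * (u + v - 2 * r))) (2 * c) r := by
      exact ((((hasDerivAt_id' r).const_mul 2).const_sub (u + v)).const_mul c).neg.congr_deriv
        (by ring)
    refine (h1.exp.mul_const (c ^ (2 - 2 * H) / 2)).congr_deriv ?_
    have e1 : c ^ (3 - 2 * H) = c ^ (2 - 2 * H) * c := by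
      rw [← Real.rpow_add_one hc.ne']; congr 1; ring
    rw [e1]; ring
  rw [intervalIntegral.integral_eq_sub_of_hasDerivAt hd
    (Continuous.intervalIntegrable (by fun_prop) _ _)]
  have : u + v - 2 * min u v = |u - v| := by
    rcases le_total u v with h | h
    · rw [min_eq_left h, abs_of_nonpos (by linarith)]; ring
    · rw [min_eq_right h, abs_of_nonneg (by linarith)]; ring
  rw [this]; simp; ring

/-- The closed form of the double integral of `e^{-c|u-v|}`. -/
theorem dbl_abs (c s t : ℝ) (hc : 0 < c) (hs : 0 ≤ s) (ht : 0 ≤ t) :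
    ∫ v in (0:ℝ)..t, ∫ u in (0:ℝ)..s, Real.exp (-(c * |u - v|))
      = ((Real.exp (-(c * s)) - 1 + c * s) + (Real.exp (-(c * t)) - 1 + c * t)
        - (Real.exp (-(c * |s - t|)) - 1 + c * |s - t|)) / c ^ 2 := by
  have hcont : Continuous (fun y : ℝ => Real.exp (-(c * |y|))) := by fun_prop
  have hii : ∀ p q : ℝ, IntervalIntegrable (fun y : ℝ => Real.exp (-(c * |y|))) volume p q :=
    fun p q => hcont.intervalIntegrable p q
  set φ : ℝ → ℝ := fun x => ∫ y in (0:ℝ)..x, Real.exp (-(c * |y|)) with hφ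
  have hφc : Continuous φ := intervalIntegral.continuous_primitive hii 0
  have hφii : ∀ p q : ℝ, IntervalIntegrable φ volume p q := fun p q => hφc.intervalIntegrable p q
  have hφodd : ∀ x, φ (-x) = - φ x := by
    intro x
    have := intervalIntegral.integral_comp_neg (a := 0) (b := x)
      (fun y : ℝ => Real.exp (-(c * |y|)))
    simp only [abs_neg, neg_zero] at this
    simp only [hφ]
    rw [this, intervalIntegral.integral_symm]
  have hφpos : ∀ x, 0 ≤ x → φ x = (1 - Real.exp (-(c * x))) / c := by
    intro x hx
    have h1 : φ x = ∫ y in (0:ℝ)..x, Real.exp (-(c * y)) := by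
      apply intervalIntegral.integral_congr
      intro y hy
      rw [Set.uIcc_of_le hx] at hy
      simp only [abs_of_nonneg hy.1]
    have hd : ∀ r ∈ Set.uIcc 0 x, HasDerivAt
      (fun r => -(Real.exp (-(c * r)) / c)) (Real.exp (-(c * r))) r := by
      intro r _
      have h2 : HasDerivAt (fun r : ℝ => -(c * r)) (-c) r := by
        exact ((hasDerivAt_id' r).const_mul c).neg.congr_deriv (by ring)
      refine (h2.exp.div_const c).neg.congr_deriv ?_
      field_simp
    rw [h1, intervalIntegral.integral_eq_sub_of_hasDerivAt hd
      (Continuous.intervalIntegrable (by fun_prop) _ _)]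
    simp; ring
  set ψ : ℝ → ℝ := fun x => ∫ y in (0:ℝ)..x, φ y with hψ
  have hψeven : ∀ x, ψ (-x) = ψ x := by
    intro x
    have := intervalIntegral.integral_comp_neg (a := 0) (b := x) φ
    simp only [hφodd, neg_zero, intervalIntegral.integral_neg] at this
    simp only [hψ]
    rw [intervalIntegral.integral_symm, ← this, neg_neg]
  have hψpos : ∀ x, 0 ≤ x → ψ x = (Real.exp (-(c * x)) - 1 + c * x) / c ^ 2 := by
    intro x hx
    have h1 : ψ x = ∫ y in (0:ℝ)..x, (1 - Real.exp (-(c * y))) / c := by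
      apply intervalIntegral.integral_congr
      intro y hy
      rw [Set.uIcc_of_le hx] at hy
      exact hφpos y hy.1
    have hd : ∀ r ∈ Set.uIcc 0 x, HasDerivAt
      (fun r => (Real.exp (-(c * r)) / c + r) / c) ((1 - Real.exp (-(c * r))) / c) r := by
      intro r _
      have h2 : HasDerivAt (fun r : ℝ => -(c * r)) (-c) r := by
        exact ((hasDerivAt_id' r).const_mul c).neg.congr_deriv (by ring)
      refine (((h2.exp.div_const c).add (hasDerivAt_id' r)).div_const c).congr_deriv ?_
      field_simp; ring
    rw [h1, intervalIntegral.integral_eq_sub_of_hasDerivAt hd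
      (Continuous.intervalIntegrable (by fun_prop) _ _)]
    simp; field_simp; ring
  have hψabs : ∀ x, ψ x = ψ |x| := by
    intro x
    rcases abs_choice x with h | h <;> rw [h]
    rw [hψeven]
  have hin : ∀ v : ℝ, ∫ u in (0:ℝ)..s, Real.exp (-(c * |u - v|)) = φ (s - v) + φ v := by
    intro v
    rw [intervalIntegral.integral_comp_sub_right (fun y : ℝ => Real.exp (-(c * |y|))) v,
      ← intervalIntegral.integral_interval_sub_left (hii 0 _) (hii 0 _)]
    change φ (s - v) - φ (0 - v) = _
    rw [zero_sub, hφodd]; ring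
  simp only [hin]
  rw [intervalIntegral.integral_add (Continuous.intervalIntegrable (by fun_prop) _ _) (hφii _ _),
    intervalIntegral.integral_comp_sub_left φ s,
    ← intervalIntegral.integral_interval_sub_left (hφii 0 _) (hφii 0 _)]
  change ψ (s - 0) - ψ (s - t) + ψ t = _
  rw [sub_zero, hψabs (s - t), hψpos s hs, hψpos t ht, hψpos _ (abs_nonneg _)]
  ring

theorem exp_int (c s : ℝ) (hc : 0 < c) :
    ∫ u in (0:ℝ)..s, Real.exp (-(c * u)) = (1 - Real.exp (-(c * s))) / c := by
  have hd : ∀ r ∈ Set.uIcc 0 s, HasDerivAt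
      (fun r => -(Real.exp (-(c * r)) / c)) (Real.exp (-(c * r))) r := by
    intro r _
    have h2 : HasDerivAt (fun r : ℝ => -(c * r)) (-c) r := by
      exact ((hasDerivAt_id' r).const_mul c).neg.congr_deriv (by ring)
    refine (h2.exp.div_const c).neg.congr_deriv ?_
    field_simp
  rw [intervalIntegral.integral_eq_sub_of_hasDerivAt hd
      (Continuous.intervalIntegrable (by fun_prop) _ _)]
  simp; ring

theorem dbl_G (c s t H : ℝ) (hc : 0 < c) (hs : 0 ≤ s) (ht : 0 ≤ t) :
    ∫ v in (0:ℝ)..t, ∫ u in (0:ℝ)..s,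
      c ^ (2 - 2 * H) / 2 * (Real.exp (-(c * |u - v|)) - Real.exp (-(c * (u + v))))
      = c ^ (-(2 * H)) * (Real.exp (-(c * s)) - 1 + c * s - (c * s) ^ 2 / 2)
        + c ^ (-(2 * H)) * (Real.exp (-(c * t)) - 1 + c * t - (c * t) ^ 2 / 2)
        - (1 / 2) * (c ^ (-(2 * H)) *
            (Real.exp (-(c * (s + t))) - 1 + c * (s + t) - (c * (s + t)) ^ 2 / 2)
          + c ^ (-(2 * H)) *
            (Real.exp (-(c * |s - t|)) - 1 + c * |s - t| - (c * |s - t|) ^ 2 / 2)) := by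
  have e1 : c ^ (2 - 2 * H) = c ^ (-(2 * H)) * c ^ 2 := by
    rw [← Real.rpow_natCast c 2, ← Real.rpow_add hc]; congr 1; push_cast; ring
  have hin : ∀ v : ℝ, ∫ u in (0:ℝ)..s,
      c ^ (2 - 2 * H) / 2 * (Real.exp (-(c * |u - v|)) - Real.exp (-(c * (u + v))))
      = c ^ (2 - 2 * H) / 2 * ((∫ u in (0:ℝ)..s, Real.exp (-(c * |u - v|)))
        - (1 - Real.exp (-(c * s))) / c * Real.exp (-(c * v))) := by
    intro v
    rw [intervalIntegral.integral_const_mul, intervalIntegral.integral_sub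
      (Continuous.intervalIntegrable (by fun_prop) _ _)
      (Continuous.intervalIntegrable (by fun_prop) _ _), ← exp_int c s hc,
      ← intervalIntegral.integral_mul_const]
    congr 3; ext u; rw [← Real.exp_add]; congr 1; ring
  simp only [hin]
  have hcont : Continuous (fun v : ℝ => ∫ u in (0:ℝ)..s, Real.exp (-(c * |u - v|))) := by
    apply intervalIntegral.continuous_parametric_intervalIntegral_of_continuous' (by fun_prop)
  rw [intervalIntegral.integral_const_mul, intervalIntegral.integral_sub
      (hcont.intervalIntegrable _ _)
      (Continuous.intervalIntegrable (by fun_prop) _ _), dbl_abs c s t hc hs ht,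
      intervalIntegral.integral_const_mul, exp_int c t hc, e1]
  have h2 : Real.exp (-(c * (s + t))) = Real.exp (-(c * s)) * Real.exp (-(c * t)) := by
    rw [← Real.exp_add]; congr 1; ring
  have h3 : (c * |s - t|) ^ 2 = c ^ 2 * (s - t) ^ 2 := by rw [mul_pow, sq_abs]
  rw [h2, h3]
  field_simp
  ring

theorem G_bound (c u v K H : ℝ) (hc : 0 < c) (hu : 0 ≤ u) (hv : 0 ≤ v) (hK : u + v ≤ K) :
    ‖c ^ (2 - 2 * H) / 2 * (Real.exp (-(c * |u - v|)) - Real.exp (-(c * (u + v))))‖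
      ≤ c ^ (2 - 2 * H) * min 1 (K * c) := by
  have h1 : Real.exp (-(c * |u - v|)) ≤ 1 := Real.exp_le_one_iff.2 (by
    have : 0 ≤ c * |u - v| := by positivity
    linarith)
  have h2 : Real.exp (-(c * (u + v))) ≤ Real.exp (-(c * |u - v|)) := by
    apply Real.exp_le_exp.2
    have : |u - v| ≤ u + v := abs_le.2 ⟨by linarith, by linarith⟩
    nlinarith
  have h3 := Real.add_one_le_exp (-(c * (u + v)))
  have h4 := Real.exp_pos (-(c * (u + v)))
  have h5 : Real.exp (-(c * |u - v|)) - Real.exp (-(c * (u + v))) ≤ min 1 (K * c) :=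
    le_min (by linarith) (by nlinarith)
  have h6 : 0 ≤ Real.exp (-(c * |u - v|)) - Real.exp (-(c * (u + v))) := by linarith
  have h7 : 0 < c ^ (2 - 2 * H) := by positivity
  rw [Real.norm_of_nonneg (by positivity)]
  nlinarith

theorem stmt5 (a b : ℝ) (ha0 : 0 < a) (ha1 : a < 1) (hb : 0 < b)
    (H : ℝ) (hH1 : 1 < H) (hH2 : H < 3 / 2) (s t : ℝ) (hs : 0 ≤ s) (ht : 0 ≤ t) :
    (∫ v in (0:ℝ)..t, ∫ u in (0:ℝ)..s, ∫ r in (0:ℝ)..(min u v),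
      ∑' j : ℤ, Real.exp (-(b * a ^ j * (u + v - 2 * r))) * (b * a ^ j) ^ (3 - 2 * H))
    = Qtil a b H s t := by
  have hc : ∀ j : ℤ, 0 < b * a ^ j := fun j => by positivity
  set c : ℤ → ℝ := fun j => b * a ^ j with hcdef
  set G : ℤ → ℝ → ℝ → ℝ := fun j u v => c j ^ (2 - 2 * H) / 2 *
    (Real.exp (-(c j * |u - v|)) - Real.exp (-(c j * (u + v)))) with hG
  set M : ℤ → ℝ := fun j => c j ^ (2 - 2 * H) * min 1 ((s + t) * c j) with hM
  have hMs : Summable M := summable_major a b ha0 ha1 hb H hH1 hH2 (s + t) (by linarith)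
  have hGM : ∀ j u v, 0 ≤ u → u ≤ s → 0 ≤ v → v ≤ t → ‖G j u v‖ ≤ M j :=
    fun j u v h1 h2 h3 h4 => G_bound (c j) u v (s + t) H (hc j) h1 h3 (by linarith)
  -- innermost interchange
  have step1 : ∀ u v, 0 ≤ u → u ≤ s → 0 ≤ v → v ≤ t →
      (∫ r in (0:ℝ)..(min u v),
      ∑' j : ℤ, Real.exp (-(b * a ^ j * (u + v - 2 * r))) * (b * a ^ j) ^ (3 - 2 * H))
      = ∑' j : ℤ, G j u v := by
    intro u v h1 h2 h3 h4
    have hm : 0 ≤ min u v := le_min h1 h3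
    have hI : ∀ j : ℤ, (∫ r in Set.Ioc 0 (min u v),
        Real.exp (-(c j * (u + v - 2 * r))) * c j ^ (3 - 2 * H)) = G j u v := by
      intro j
      rw [← intervalIntegral.integral_of_le hm]
      exact inner_r (c j) u v (hc j) H
    rw [intervalIntegral.integral_of_le hm]
    have := hasSum_integral_of_summable_integral_norm (μ := volume.restrict (Set.Ioc 0 (min u v)))
      (F := fun (j : ℤ) (r : ℝ) => Real.exp (-(c j * (u + v - 2 * r))) * c j ^ (3 - 2 * H))
      (fun j => by
        have : Continuous (fun r : ℝ =>
          Real.exp (-(c j * (u + v - 2 * r))) * c j ^ (3 - 2 * H)) := by fun_prop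
        exact (intervalIntegrable_iff_integrableOn_Ioc_of_le hm).1 (this.intervalIntegrable _ _))
      (by
        have e : ∀ (j : ℤ) (r : ℝ), ‖Real.exp (-(c j * (u + v - 2 * r))) * c j ^ (3 - 2 * H)‖
          = Real.exp (-(c j * (u + v - 2 * r))) * c j ^ (3 - 2 * H) := by
          intro j r
          have := hc j
          exact Real.norm_of_nonneg (mul_nonneg (Real.exp_pos _).le (Real.rpow_nonneg this.le _))
        simp only [e, hI]
        exact Summable.of_norm_bounded hMs (fun j => hGM j u v h1 h2 h3 h4))
    simp only [hI] at this
    exact this.tsum_eq.symm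
  have hGc : ∀ j, Continuous (fun p : ℝ × ℝ => G j p.1 p.2) := by
    intro j; simp only [hG]; fun_prop
  have hIoc : ∀ {x y : ℝ}, 0 ≤ y → x ∈ Set.uIoc 0 y → 0 ≤ x ∧ x ≤ y := by
    intro x y hy hx
    rw [Set.uIoc_of_le hy] at hx
    exact ⟨hx.1.le, hx.2⟩
  have step2 : ∀ v, 0 ≤ v → v ≤ t → HasSum (fun j => ∫ u in (0:ℝ)..s, G j u v)
      (∫ u in (0:ℝ)..s, ∑' j : ℤ, G j u v) := by
    intro v h3 h4
    refine intervalIntegral.hasSum_integral_of_dominated_convergence (fun j _ => M j)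
      (fun j => ?_) (fun j => ?_) ?_ ?_ ?_
    · have : Continuous (fun u => G j u v) :=
        (hGc j).comp (continuous_id.prodMk continuous_const)
      exact this.aestronglyMeasurable
    · exact Filter.Eventually.of_forall fun u hu =>
        hGM j u v (hIoc hs hu).1 (hIoc hs hu).2 h3 h4
    · exact Filter.Eventually.of_forall fun u hu => hMs
    · exact intervalIntegrable_const
    · exact Filter.Eventually.of_forall fun u hu => (Summable.of_norm_bounded hMs
        (fun j => hGM j u v (hIoc hs hu).1 (hIoc hs hu).2 h3 h4)).hasSum
  have hMid : ∀ j v, 0 ≤ v → v ≤ t → ‖∫ u in (0:ℝ)..s, G j u v‖ ≤ M j * s := by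
    intro j v h3 h4
    have := intervalIntegral.norm_integral_le_of_norm_le_const (a := 0) (b := s)
      (f := fun u => G j u v) (C := M j)
      (fun u hu => hGM j u v (hIoc hs hu).1 (hIoc hs hu).2 h3 h4)
    rwa [sub_zero, abs_of_nonneg hs] at this
  have step3 : HasSum (fun j => ∫ v in (0:ℝ)..t, ∫ u in (0:ℝ)..s, G j u v)
      (∫ v in (0:ℝ)..t, ∫ u in (0:ℝ)..s, ∑' j : ℤ, G j u v) := by
    refine intervalIntegral.hasSum_integral_of_dominated_convergence (fun j _ => M j * s)
      (fun j => ?_) (fun j => ?_) ?_ ?_ ?_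
    · have : Continuous (fun v => ∫ u in (0:ℝ)..s, G j u v) :=
        intervalIntegral.continuous_parametric_intervalIntegral_of_continuous'
          (f := fun v u => G j u v) ((hGc j).comp continuous_swap) _ _
      exact this.aestronglyMeasurable
    · exact Filter.Eventually.of_forall fun v hv => hMid j v (hIoc ht hv).1 (hIoc ht hv).2
    · exact Filter.Eventually.of_forall fun u hu => hMs.mul_right s
    · exact intervalIntegrable_const
    · exact Filter.Eventually.of_forall fun v hv => step2 v (hIoc ht hv).1 (hIoc ht hv).2
  have step4 : (∫ v in (0:ℝ)..t, ∫ u in (0:ℝ)..s, ∫ r in (0:ℝ)..(min u v),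
      ∑' j : ℤ, Real.exp (-(b * a ^ j * (u + v - 2 * r))) * (b * a ^ j) ^ (3 - 2 * H))
      = ∫ v in (0:ℝ)..t, ∫ u in (0:ℝ)..s, ∑' j : ℤ, G j u v := by
    apply intervalIntegral.integral_congr
    intro v hv
    rw [Set.uIcc_of_le ht] at hv
    apply intervalIntegral.integral_congr
    intro u hu
    rw [Set.uIcc_of_le hs] at hu
    exact step1 u v hu.1 hu.2 hv.1 hv.2
  rw [step4]
  refine step3.unique ?_
  have hD : ∀ j, (∫ v in (0:ℝ)..t, ∫ u in (0:ℝ)..s, G j u v) = _ :=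
    fun j => dbl_G (c j) s t H (hc j) hs ht
  simp only [hD]
  have hS : ∀ x, 0 ≤ x → HasSum (fun j : ℤ => (c j) ^ (-(2 * H)) *
      (Real.exp (-(c j * x)) - 1 + c j * x - (c j * x) ^ 2 / 2)) (x ^ (2 * H) * htil a b H x) := by
    intro x hx
    rw [htil_eq a b ha0 hb H hH1 x hx]
    exact (summable_g a b ha0 ha1 hb H hH1 hH2 x hx).hasSum
  exact ((hS s hs).add (hS t ht)).sub
    (((hS (s + t) (by linarith)).add (hS |s - t| (abs_nonneg _))).mul_left (1 / 2))
end

section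
/- For every H in (1/2, 1) and every t > 0, t^{2H} h_t = ∫_0^∞ (sin²(t u) / u²) · 2σ(2u) du, where σ(u) = (1/π) Σ_{j∈ℤ} (b a^j)^{3-2H} / ((b a^j)² + u²). -/
open Real MeasureTheory

/-- The spectral-type density `σ(u) = (1/π) Σ_{j∈ℤ} (b a^j)^{3-2H} / ((b a^j)² + u²)`. -/
noncomputable def sigosc (a b H u : ℝ) : ℝ :=
  (1 / π) * ∑' j : ℤ, (b * a ^ j) ^ (3 - 2 * H) / ((b * a ^ j) ^ 2 + u ^ 2)

lemma exp_abs_integrable (k : ℝ) (hk : 0 < k) :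
    Integrable (fun x : ℝ => ((Real.exp (-(k * |x|)) : ℝ) : ℂ)) := by
  suffices h : Integrable (fun x : ℝ => Real.exp (-(k * |x|))) from h.ofReal
  by_contra hn
  have h0 := integral_undef hn
  have h1 := integral_exp_mul_Ioi (a := -k) (by linarith) 0
  simp only [neg_mul] at h1
  rw [integral_comp_abs (f := fun x => Real.exp (-(k * x))), h1] at h0
  simp at h0
  linarith

lemma fourier_exp_abs (k : ℝ) (hk : 0 < k) (w : ℝ) :
    FourierTransform.fourier (fun x : ℝ => ((Real.exp (-(k * |x|)) : ℝ) : ℂ)) w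
      = ((2 * k / (k ^ 2 + 4 * π ^ 2 * w ^ 2) : ℝ) : ℂ) := by
  rw [Real.fourier_real_eq_integral_exp_smul]
  have hint : Integrable (fun v : ℝ => Complex.exp (↑(-2 * π * v * w) * Complex.I) •
      ((Real.exp (-(k * |v|)) : ℝ) : ℂ)) := by
    have := (exp_abs_integrable k hk).bdd_mul (f := fun v : ℝ => Complex.exp (↑(-2 * π * v * w) * Complex.I)) (c := 1) (by fun_prop) (by
      filter_upwards with v
      rw [Complex.norm_exp_ofReal_mul_I])
    simpa using this
  rw [← intervalIntegral.integral_Iic_add_Ioi hint.integrableOn hint.integrableOn (b := 0)]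
  have e1 : ∫ v in Set.Iic (0:ℝ), Complex.exp (↑(-2 * π * v * w) * Complex.I) •
      ((Real.exp (-(k * |v|)) : ℝ) : ℂ) = 1 / (k - 2 * π * w * Complex.I) := by
    have := integral_exp_mul_complex_Iic (a := k - 2 * π * w * Complex.I) (by simp [hk]) 0
    simp only [Complex.ofReal_zero, mul_zero, Complex.exp_zero] at this
    rw [← this]
    refine setIntegral_congr_fun measurableSet_Iic ?_
    intro v hv
    have hv' : v ≤ 0 := hv
    simp only [abs_of_nonpos hv', smul_eq_mul]
    push_cast
    rw [← Complex.exp_add]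
    congr 1; ring
  have e2 : ∫ v in Set.Ioi (0:ℝ), Complex.exp (↑(-2 * π * v * w) * Complex.I) •
      ((Real.exp (-(k * |v|)) : ℝ) : ℂ) = 1 / (k + 2 * π * w * Complex.I) := by
    have := integral_exp_mul_complex_Ioi (a := -(k + 2 * π * w * Complex.I)) (by simp [hk]) 0
    simp only [Complex.ofReal_zero, mul_zero, Complex.exp_zero, neg_div_neg_eq] at this
    rw [← this]
    refine setIntegral_congr_fun measurableSet_Ioi ?_
    intro v hv
    have hv' : 0 < v := hv
    simp only [abs_of_pos hv', smul_eq_mul]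
    push_cast
    rw [← Complex.exp_add]
    congr 1; ring
  rw [e1, e2]
  have h1 : (k - 2 * π * w * Complex.I : ℂ) ≠ 0 := by
    intro h; have := congrArg Complex.re h; simp at this; linarith
  have h2 : (k + 2 * π * w * Complex.I : ℂ) ≠ 0 := by
    intro h; have := congrArg Complex.re h; simp at this; linarith
  have h3 : ((k ^ 2 + 4 * π ^ 2 * w ^ 2 : ℝ) : ℂ) = (k - 2 * π * w * Complex.I) * (k + 2 * π * w * Complex.I) := by
    push_cast; ring_nf; simp [Complex.I_sq]
  rw [Complex.ofReal_div, h3]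
  field_simp
  push_cast; ring

lemma lorentz_integrable (c k : ℝ) (hc : 0 < c) (hk : 0 < k) :
    Integrable (fun u : ℝ => 1 / (c ^ 2 + k ^ 2 * u ^ 2)) := by
  have h := (integrable_inv_one_add_sq.comp_mul_left' (R := k / c) (by positivity)).const_mul (1 / c ^ 2)
  refine h.congr ?_
  filter_upwards with u
  field_simp

lemma cos_lorentz (c : ℝ) (hc : 0 < c) (s : ℝ) (hs : 0 ≤ s) :
    ∫ u in Set.Ioi (0:ℝ), Real.cos (2 * s * u) / (c ^ 2 + 4 * u ^ 2)
      = π / (4 * c) * Real.exp (-(c * s)) := by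
  have hF : FourierTransform.fourier (fun x : ℝ => ((Real.exp (-(c * |x|)) : ℝ) : ℂ))
      = fun w => ((2 * c / (c ^ 2 + 4 * π ^ 2 * w ^ 2) : ℝ) : ℂ) := by
    ext w; exact fourier_exp_abs c hc w
  have hI : Integrable (fun w : ℝ => ((2 * c / (c ^ 2 + 4 * π ^ 2 * w ^ 2) : ℝ) : ℂ)) := by
    suffices h : Integrable (fun w : ℝ => 2 * c / (c ^ 2 + 4 * π ^ 2 * w ^ 2)) from h.ofReal
    refine ((lorentz_integrable c (2 * π) hc (by positivity)).const_mul (2 * c)).congr ?_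
    filter_upwards with u
    ring_nf
  have hinv := (exp_abs_integrable c hc).fourierInv_fourier_eq (by rw [hF]; exact hI)
    (v := s) (Continuous.continuousAt (by fun_prop))
  rw [hF, Real.fourierInv_eq'] at hinv
  have hre := congrArg Complex.re hinv
  have hint : Integrable (fun v : ℝ => Complex.exp (↑(2 * π * inner ℝ v s) * Complex.I) •
      ((2 * c / (c ^ 2 + 4 * π ^ 2 * v ^ 2) : ℝ) : ℂ)) := by
    have := hI.bdd_mul (f := fun v : ℝ => Complex.exp (↑(2 * π * inner ℝ v s) * Complex.I)) (c := 1) (by fun_prop) (by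
      filter_upwards with v
      rw [Complex.norm_exp_ofReal_mul_I])
    simpa using this
  have hr := integral_re hint
  simp only [RCLike.re_to_complex] at hr
  rw [← hr, Complex.ofReal_re, abs_of_nonneg hs] at hre
  have h2 : ∀ v : ℝ, (Complex.exp (↑(2 * π * inner ℝ v s) * Complex.I) •
      ((2 * c / (c ^ 2 + 4 * π ^ 2 * v ^ 2) : ℝ) : ℂ)).re
      = Real.cos (2 * s * (π * |v|)) * (2 * c / (c ^ 2 + 4 * (π * |v|) ^ 2)) := by
    intro v
    rw [smul_eq_mul, Complex.re_mul_ofReal, Complex.exp_ofReal_mul_I_re]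
    have : Real.cos (2 * s * (π * |v|)) = Real.cos (2 * π * inner ℝ v s) := by
      rw [← Real.cos_abs (2 * π * inner ℝ v s)]
      congr 1
      simp [abs_mul, abs_of_nonneg hs, abs_of_pos pi_pos]; ring
    rw [this, mul_pow, sq_abs]
    ring_nf
  simp_rw [h2] at hre
  rw [integral_comp_abs (f := fun v => Real.cos (2 * s * (π * v)) * (2 * c / (c ^ 2 + 4 * (π * v) ^ 2))),
    integral_comp_mul_left_Ioi (fun x => Real.cos (2 * s * x) * (2 * c / (c ^ 2 + 4 * x ^ 2))) 0 pi_pos, mul_zero] at hre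
  have h3 : ∫ x in Set.Ioi (0:ℝ), Real.cos (2 * s * x) * (2 * c / (c ^ 2 + 4 * x ^ 2))
      = 2 * c * ∫ u in Set.Ioi (0:ℝ), Real.cos (2 * s * u) / (c ^ 2 + 4 * u ^ 2) := by
    rw [← integral_const_mul]
    congr 1; ext x; ring
  rw [h3] at hre
  rw [← hre, smul_eq_mul]
  generalize (∫ u in Set.Ioi (0:ℝ), Real.cos (2 * s * u) / (c ^ 2 + 4 * u ^ 2)) = J
  field_simp
  ring

lemma sin_sq_repr (t u : ℝ) (hu : 0 < u) :
    ∫ s in (0:ℝ)..t, 2 * (t - s) * Real.cos (2 * s * u) = Real.sin (t * u) ^ 2 / u ^ 2 := by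
  have hd : ∀ s ∈ Set.uIcc 0 t, HasDerivAt
      (fun s => (t - s) * Real.sin (2 * s * u) / u - Real.cos (2 * s * u) / (2 * u ^ 2))
      (2 * (t - s) * Real.cos (2 * s * u)) s := by
    intro s _
    have h0 : HasDerivAt (fun s : ℝ => 2 * s * u) (2 * u) s := by
      simpa using ((hasDerivAt_id s).const_mul 2).mul_const u
    have h1 := ((((hasDerivAt_id s).const_sub t).mul h0.sin).div_const u).sub
      (h0.cos.div_const (2 * u ^ 2))
    refine HasDerivAt.congr_deriv h1 ?_
    simp only [id, Pi.neg_apply]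
    field_simp
    ring
  rw [intervalIntegral.integral_eq_sub_of_hasDerivAt hd (Continuous.intervalIntegrable (by fun_prop) _ _)]
  have : 2 * t * u = 2 * (t * u) := by ring
  rw [this, Real.cos_two_mul, Real.cos_sq']
  simp
  field_simp
  ring

lemma exp_repr (c t : ℝ) (hc : 0 < c) :
    ∫ s in (0:ℝ)..t, 2 * (t - s) * (π / (4 * c) * Real.exp (-(c * s)))
      = π / (2 * c ^ 3) * (Real.exp (-(c * t)) - 1 + c * t) := by
  have hd : ∀ s ∈ Set.uIcc 0 t, HasDerivAt
      (fun s => π / (2 * c) * (-(t - s) / c + 1 / c ^ 2) * Real.exp (-(c * s)))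
      (2 * (t - s) * (π / (4 * c) * Real.exp (-(c * s)))) s := by
    intro s _
    have h0 : HasDerivAt (fun s : ℝ => -(c * s)) (-c) s := by
      exact (by simpa using (hasDerivAt_id s).const_mul c : HasDerivAt (fun s : ℝ => c * s) c s).neg
    have h1 := (((((hasDerivAt_id s).const_sub t).neg.div_const c).add_const (1 / c ^ 2)).const_mul
      (π / (2 * c))).mul h0.exp
    refine HasDerivAt.congr_deriv h1 ?_
    simp only [id, Pi.neg_apply]
    field_simp
    ring
  rw [intervalIntegral.integral_eq_sub_of_hasDerivAt hd (Continuous.intervalIntegrable (by fun_prop) _ _)]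
  simp
  field_simp
  ring

lemma main_int (c t : ℝ) (hc : 0 < c) (ht : 0 < t) :
    ∫ u in Set.Ioi (0:ℝ), Real.sin (t * u) ^ 2 / u ^ 2 / (c ^ 2 + 4 * u ^ 2)
      = π / (2 * c ^ 3) * (Real.exp (-(c * t)) - 1 + c * t) := by
  have hint : Integrable (Function.uncurry fun s u : ℝ =>
      2 * (t - s) * (Real.cos (2 * s * u) / (c ^ 2 + 4 * u ^ 2)))
      ((volume.restrict (Set.uIoc 0 t)).prod (volume.restrict (Set.Ioi 0))) := by
    have hA : Integrable (fun s : ℝ => 2 * (t - s)) (volume.restrict (Set.uIoc 0 t)) := by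
      rw [← IntegrableOn, ← intervalIntegrable_iff]
      exact Continuous.intervalIntegrable (by fun_prop) _ _
    have hB : Integrable (fun u : ℝ => 1 / (c ^ 2 + 2 ^ 2 * u ^ 2)) (volume.restrict (Set.Ioi 0)) :=
      (lorentz_integrable c 2 hc two_pos).integrableOn
    have := (hA.mul_prod hB).bdd_mul (f := fun p : ℝ × ℝ => Real.cos (2 * p.1 * p.2)) (c := 1)
      (Continuous.aestronglyMeasurable (by fun_prop)) (by
        filter_upwards with p
        exact Real.abs_cos_le_one _)
    refine this.congr ?_
    filter_upwards with p
    simp only [Function.uncurry]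
    ring
  have hsw := intervalIntegral_integral_swap hint
  rw [← exp_repr c t hc]
  have hl : ∫ s in (0:ℝ)..t, 2 * (t - s) * (π / (4 * c) * Real.exp (-(c * s)))
      = ∫ s in (0:ℝ)..t, ∫ u in Set.Ioi (0:ℝ), 2 * (t - s) * (Real.cos (2 * s * u) / (c ^ 2 + 4 * u ^ 2)) := by
    apply intervalIntegral.integral_congr
    intro s hs
    rw [Set.uIcc_of_le ht.le] at hs
    simp only
    rw [integral_const_mul, cos_lorentz c hc s hs.1]
  rw [hl, hsw]
  refine setIntegral_congr_fun measurableSet_Ioi ?_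
  intro u hu
  simp only
  rw [← sin_sq_repr t u hu, ← intervalIntegral.integral_div]
  congr 1; ext s; ring

lemma exp_le_aux (x : ℝ) (hx : 0 < x) : 0 < Real.exp (-x) - 1 + x ∧
    Real.exp (-x) - 1 + x ≤ x ∧ Real.exp (-x) - 1 + x ≤ x ^ 2 := by
  refine ⟨?_, ?_, ?_⟩
  · have := Real.add_one_lt_exp (x := -x) (by linarith); linarith
  · have := Real.exp_le_one_iff.2 (by linarith : -x ≤ 0); linarith
  · rw [Real.exp_neg]
    have h1 := Real.add_one_lt_exp (x := x) (by linarith)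
    have h2 : (Real.exp x)⁻¹ ≤ (x + 1)⁻¹ := by gcongr
    have h3 : (x + 1)⁻¹ ≤ 1 - x + x ^ 2 := by
      rw [inv_le_iff_one_le_mul₀ (by linarith)]; nlinarith [pow_pos hx 3]
    linarith

lemma term_summable (a b H t : ℝ) (ha0 : 0 < a) (ha1 : a < 1) (hb : 0 < b)
    (hH1 : 1 / 2 < H) (hH2 : H < 1) (ht : 0 < t) :
    Summable (fun j : ℤ => (b * a ^ j * t) ^ (-(2 * H)) *
    (Real.exp (-(b * a ^ j * t)) - 1 + b * a ^ j * t)) := by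
  have hpos : ∀ j : ℤ, 0 < b * a ^ j * t := fun j => by positivity
  have hnn : ∀ j : ℤ, 0 ≤ (b * a ^ j * t) ^ (-(2 * H)) *
    (Real.exp (-(b * a ^ j * t)) - 1 + b * a ^ j * t) := fun j =>
    mul_nonneg (rpow_nonneg (hpos j).le _) (exp_le_aux _ (hpos j)).1.le
  apply Summable.of_nat_of_neg
  · have hg : Summable (fun n : ℕ => (b * t) ^ (2 - 2 * H) * (a ^ (2 - 2 * H)) ^ n) :=
      (summable_geometric_of_lt_one (by positivity)
        (Real.rpow_lt_one ha0.le ha1 (by linarith))).mul_left _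
    refine hg.of_nonneg_of_le (fun n => hnn n) (fun n => ?_)
    calc _ ≤ (b * a ^ (n:ℤ) * t) ^ (-(2 * H)) * (b * a ^ (n:ℤ) * t) ^ 2 := by
          gcongr; exact (exp_le_aux _ (hpos n)).2.2
      _ = (b * a ^ (n:ℤ) * t) ^ (2 - 2 * H) := by
          rw [← Real.rpow_natCast, ← Real.rpow_add (hpos n)]; congr 1; push_cast; ring
      _ = ((b * t) * a ^ n) ^ (2 - 2 * H) := by
          rw [zpow_natCast]; congr 1; ring
      _ = _ := by
          rw [Real.mul_rpow (by positivity) (by positivity), ← Real.rpow_natCast,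
            ← Real.rpow_natCast, ← Real.rpow_mul ha0.le, ← Real.rpow_mul ha0.le, mul_comm (n:ℝ)]
  · have hg : Summable (fun n : ℕ => (b * t) ^ (1 - 2 * H) * (a ^ (2 * H - 1)) ^ n) :=
      (summable_geometric_of_lt_one (by positivity)
        (Real.rpow_lt_one ha0.le ha1 (by linarith))).mul_left _
    refine hg.of_nonneg_of_le (fun n => hnn _) (fun n => ?_)
    calc _ ≤ (b * a ^ (-(n:ℤ)) * t) ^ (-(2 * H)) * (b * a ^ (-(n:ℤ)) * t) ^ (1:ℝ) := by
          rw [Real.rpow_one]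
          gcongr; exact (exp_le_aux _ (hpos _)).2.1
      _ = (b * a ^ (-(n:ℤ)) * t) ^ (1 - 2 * H) := by
          rw [← Real.rpow_add (hpos _)]; congr 1; ring
      _ = ((b * t) * a ^ (-(n:ℝ))) ^ (1 - 2 * H) := by
          rw [zpow_neg, zpow_natCast, Real.rpow_neg ha0.le, Real.rpow_natCast]; congr 1; ring
      _ = _ := by
          rw [Real.mul_rpow (by positivity) (by positivity), ← Real.rpow_natCast,
            ← Real.rpow_mul ha0.le, ← Real.rpow_mul ha0.le]
          congr 2; ring

theorem stmt6 (a b : ℝ) (ha0 : 0 < a) (ha1 : a < 1) (hb : 0 < b)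
    (H : ℝ) (hH1 : 1 / 2 < H) (hH2 : H < 1) (t : ℝ) (ht : 0 < t) :
    t ^ (2 * H) * hosc a b H t
      = ∫ u in Set.Ioi (0:ℝ), (Real.sin (t * u)) ^ 2 / u ^ 2 * (2 * sigosc a b H (2 * u)) := by
  set F : ℤ → ℝ → ℝ := fun j u => Real.sin (t * u) ^ 2 / u ^ 2 * (2 * ((1 / π) *
    ((b * a ^ j) ^ (3 - 2 * H) / ((b * a ^ j) ^ 2 + (2 * u) ^ 2)))) with hF
  have hc : ∀ j : ℤ, 0 < b * a ^ j := fun j => by positivity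
  have hFnn : ∀ j u, 0 ≤ F j u := by
    intro j u
    have := hc j
    simp only [hF]
    positivity
  have hFint : ∀ j : ℤ, ∫ u in Set.Ioi (0:ℝ), F j u = t ^ (2 * H) * ((b * a ^ j * t) ^ (-(2 * H)) *
    (Real.exp (-(b * a ^ j * t)) - 1 + b * a ^ j * t)) := by
    intro j
    have hcj := hc j
    have h1 : ∫ u in Set.Ioi (0:ℝ), F j u = 2 / π * (b * a ^ j) ^ (3 - 2 * H) *
        ∫ u in Set.Ioi (0:ℝ), Real.sin (t * u) ^ 2 / u ^ 2 / ((b * a ^ j) ^ 2 + 4 * u ^ 2) := by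
      rw [← integral_const_mul]
      congr 1; ext u; simp only [hF]; ring
    rw [h1, main_int _ t hcj ht, Real.mul_rpow hcj.le ht.le, sub_eq_add_neg, Real.rpow_add hcj,
      Real.rpow_neg ht.le]
    have h3 : (b * a ^ j) ^ (3:ℝ) = (b * a ^ j) ^ 3 := by
      rw [← Real.rpow_natCast]; norm_num
    rw [h3]
    generalize (b * a ^ j) = c at *
    have := Real.rpow_pos_of_pos ht (2 * H)
    field_simp
  have hFi : ∀ j, Integrable (F j) (volume.restrict (Set.Ioi 0)) := by
    intro j
    by_contra hn
    have h0 := integral_undef hn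
    rw [hFint j] at h0
    have h1 : 0 < b * a ^ j * t := mul_pos (hc j) ht
    have := (exp_le_aux _ h1).1
    have h2 : 0 < t ^ (2 * H) * ((b * a ^ j * t) ^ (-(2 * H)) *
      (Real.exp (-(b * a ^ j * t)) - 1 + b * a ^ j * t)) := by positivity
    linarith
  have hS := hasSum_integral_of_summable_integral_norm hFi (by
    have he : ∀ j, ∫ u in Set.Ioi (0:ℝ), ‖F j u‖ = ∫ u in Set.Ioi (0:ℝ), F j u := by
      intro j; congr 1; ext u; exact Real.norm_of_nonneg (hFnn j u)
    simp_rw [he, hFint]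
    exact (term_summable a b H t ha0 ha1 hb hH1 hH2 ht).mul_left _)
  rw [hosc, ← tsum_mul_left]
  simp_rw [← hFint]
  rw [hS.tsum_eq]
  congr 1; ext u
  simp only [hF, sigosc, tsum_mul_left]
end

section
/- For every H in (1/2, 1) the osfBm covariance kernel Q_H is positive semidefinite on [0,∞), and for every H in (1, 3/2) the onsfBm covariance kernel Q̃_H is positive semidefinite on [0,∞): in each case, for every n ≥ 1, all t₁, …, t_n ≥ 0 and all real c₁, …, c_n, the double sum Σ_{i,k} c_i c_k of the kernel evaluated at (t_i, t_k) is nonnegative. (Hence centered Gaussian processes with these covariances, the osfBm and the onsfBm, exist.) -/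
open Real

/-- The oscillatory sub-fractional Brownian motion covariance `Q_H(s,t)`. -/
noncomputable def Qcov (a b H s t : ℝ) : ℝ :=
  s ^ (2 * H) * hosc a b H s + t ^ (2 * H) * hosc a b H t
    - (1 / 2) * ((s + t) ^ (2 * H) * hosc a b H (s + t)
      + |s - t| ^ (2 * H) * hosc a b H |s - t|)

/-- The elementary kernel. -/
noncomputable def Kel (s t : ℝ) : ℝ :=
  min s t + Real.exp (-s) + Real.exp (-t) - 1
    - (1 / 2) * (Real.exp (-(s + t)) + Real.exp (-|s - t|))

/-- The feature function. -/
noncomputable def Fel (s u : ℝ) : ℝ := max 0 (1 - Real.exp (u - s))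

lemma Fel_cont (s : ℝ) : Continuous (Fel s) := by
  unfold Fel; fun_prop

lemma Kel_symm (s t : ℝ) : Kel s t = Kel t s := by
  unfold Kel
  rw [min_comm, add_comm s t, abs_sub_comm]; ring

lemma Fel_int_aux (s t T : ℝ) (ht : 0 ≤ t) (hts : t ≤ s) (hT : t ≤ T) :
    ∫ u in (0:ℝ)..T, Fel s u * Fel t u = Kel s t := by
  have hc : Continuous (fun u => Fel s u * Fel t u) := (Fel_cont s).mul (Fel_cont t)
  rw [← intervalIntegral.integral_add_adjacent_intervals (b := t)
    (hc.intervalIntegrable _ _) (hc.intervalIntegrable _ _)]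
  have h2 : ∫ u in t..T, Fel s u * Fel t u = 0 := by
    rw [intervalIntegral.integral_congr (g := fun _ => (0:ℝ))]
    · simp
    · intro u hu
      rw [Set.uIcc_of_le hT] at hu
      have : Fel t u = 0 := by
        unfold Fel
        apply max_eq_left
        have : 1 ≤ Real.exp (u - t) := Real.one_le_exp (by linarith [hu.1])
        linarith
      simp [this]
  have h1 : ∫ u in (0:ℝ)..t, Fel s u * Fel t u
      = ∫ u in (0:ℝ)..t, (1 - Real.exp (u - s)) * (1 - Real.exp (u - t)) := by
    apply intervalIntegral.integral_congr
    intro u hu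
    rw [Set.uIcc_of_le ht] at hu
    have e1 : Real.exp (u - s) ≤ 1 := Real.exp_le_one_iff.2 (by linarith [hu.2])
    have e2 : Real.exp (u - t) ≤ 1 := Real.exp_le_one_iff.2 (by linarith [hu.2])
    simp only [Fel]
    rw [max_eq_right (by linarith), max_eq_right (by linarith)]
  rw [h1, h2, add_zero]
  have hd : ∀ u ∈ Set.uIcc 0 t, HasDerivAt
      (fun u => u - Real.exp (u - s) - Real.exp (u - t) + Real.exp (2 * u - s - t) / 2)
      ((1 - Real.exp (u - s)) * (1 - Real.exp (u - t))) u := by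
    intro u _
    have d1 : HasDerivAt (fun u : ℝ => Real.exp (u - s)) (Real.exp (u - s) * 1) u :=
      ((hasDerivAt_id u).sub_const s).exp
    have d2 : HasDerivAt (fun u : ℝ => Real.exp (u - t)) (Real.exp (u - t) * 1) u :=
      ((hasDerivAt_id u).sub_const t).exp
    have d3 : HasDerivAt (fun u : ℝ => Real.exp (2 * u - s - t))
        (Real.exp (2 * u - s - t) * (2 * 1)) u :=
      ((((hasDerivAt_id u).const_mul 2).sub_const s).sub_const t).exp
    refine ((((hasDerivAt_id u).sub d1).sub d2).add (d3.div_const 2)).congr_deriv ?_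
    have : Real.exp (2 * u - s - t) = Real.exp (u - s) * Real.exp (u - t) := by
      rw [← Real.exp_add]; ring_nf
    rw [this]; ring
  rw [intervalIntegral.integral_eq_sub_of_hasDerivAt hd
    (Continuous.intervalIntegrable (by fun_prop) _ _)]
  unfold Kel
  rw [min_eq_right hts, abs_of_nonneg (by linarith : 0 ≤ s - t)]
  have e1 : (2 * t - s - t) = -(s - t) := by ring
  have e2 : t - s = -(s - t) := by ring
  have e3 : 2 * 0 - s - t = -(s + t) := by ring
  rw [e1, e2, e3, sub_self, Real.exp_zero, zero_sub, zero_sub]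
  ring

lemma Fel_int (s t T : ℝ) (hs : 0 ≤ s) (ht : 0 ≤ t) (hsT : s ≤ T) (htT : t ≤ T) :
    ∫ u in (0:ℝ)..T, Fel s u * Fel t u = Kel s t := by
  rcases le_total t s with h | h
  · exact Fel_int_aux s t T ht h htT
  · rw [Kel_symm, ← Fel_int_aux t s T hs h hsT]
    simp only [mul_comm]

lemma Kel_psd {n : ℕ} (t c : Fin n → ℝ) (ht : ∀ i, 0 ≤ t i) :
    0 ≤ ∑ i, ∑ k, c i * c k * Kel (t i) (t k) := by
  have hT : ∀ i, t i ≤ ∑ k, t k := fun i =>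
    Finset.single_le_sum (fun k _ => ht k) (Finset.mem_univ i)
  have hT0 : 0 ≤ ∑ k, t k := Finset.sum_nonneg fun k _ => ht k
  have key : ∑ i, ∑ k, c i * c k * Kel (t i) (t k)
      = ∫ u in (0:ℝ)..(∑ k, t k), (∑ i, c i * Fel (t i) u) ^ 2 := by
    have : ∀ u, (∑ i, c i * Fel (t i) u) ^ 2
        = ∑ i, ∑ k, c i * c k * (Fel (t i) u * Fel (t k) u) := by
      intro u
      rw [sq, Finset.sum_mul_sum]
      refine Finset.sum_congr rfl fun i _ => Finset.sum_congr rfl fun k _ => by ring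
    simp only [this]
    have hc : ∀ i k, Continuous (fun u => c i * c k * (Fel (t i) u * Fel (t k) u)) :=
      fun i k => continuous_const.mul ((Fel_cont _).mul (Fel_cont _))
    rw [intervalIntegral.integral_finsetSum]
    · refine Finset.sum_congr rfl fun i _ => ?_
      rw [intervalIntegral.integral_finsetSum]
      · refine Finset.sum_congr rfl fun k _ => ?_
        rw [intervalIntegral.integral_const_mul,
          Fel_int _ _ _ (ht i) (ht k) (hT i) (hT k)]
      · exact fun k _ => (hc i k).intervalIntegrable _ _
    · exact fun i _ =>
        (continuous_finsetSum _ fun k _ => hc i k).intervalIntegrable _ _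
  rw [key]
  exact intervalIntegral.integral_nonneg hT0 fun u _ => sq_nonneg _

lemma term_bound (c a p : ℝ) (m : ℕ) (hc : 0 < c) (ha : 0 < a) (g : ℝ → ℝ)
    (hg : ∀ x, 0 < x → |g x| ≤ x ^ m) (j : ℤ) :
    |(c * a ^ j) ^ (-p) * g (c * a ^ j)| ≤ c ^ ((m:ℝ) - p) * (a ^ ((m:ℝ) - p)) ^ j := by
  have hx : 0 < c * a ^ j := by positivity
  rw [abs_mul, abs_of_pos (Real.rpow_pos_of_pos hx _)]
  calc _ ≤ (c * a ^ j) ^ (-p) * (c * a ^ j) ^ m := by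
        gcongr; exact hg _ hx
    _ = (c * a ^ j) ^ ((m:ℝ) - p) := by
        rw [← Real.rpow_natCast (c * a ^ j) m, ← Real.rpow_add hx]; ring_nf
    _ = _ := by
        rw [Real.mul_rpow hc.le (by positivity), ← Real.rpow_intCast, ← Real.rpow_mul ha.le,
          ← Real.rpow_intCast, ← Real.rpow_mul ha.le, mul_comm (j:ℝ)]

lemma summ_gen (c a p : ℝ) (m : ℕ) (hc : 0 < c) (ha : 0 < a) (ha1 : a < 1) (g : ℝ → ℝ)
    (hg : ∀ x, 0 < x → |g x| ≤ x ^ m) (hg' : ∀ x, 0 < x → |g x| ≤ x ^ (m + 1))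
    (hp : (m:ℝ) < p) (hp' : p < m + 1) :
    Summable fun j : ℤ => (c * a ^ j) ^ (-p) * g (c * a ^ j) := by
  apply Summable.of_nat_of_neg
  · refine Summable.of_norm_bounded
      (g := fun n : ℕ => c ^ (((m + 1 : ℕ):ℝ) - p) * (a ^ (((m + 1 : ℕ):ℝ) - p)) ^ n) ?_ ?_
    · apply Summable.mul_left
      apply summable_geometric_of_lt_one (by positivity)
      apply Real.rpow_lt_one ha.le ha1
      push_cast; linarith
    · intro n
      simpa using term_bound c a p (m + 1) hc ha g hg' n
  · refine Summable.of_norm_bounded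
      (g := fun n : ℕ => c ^ ((m:ℝ) - p) * ((a ^ ((m:ℝ) - p))⁻¹) ^ n) ?_ ?_
    · apply Summable.mul_left
      apply summable_geometric_of_lt_one (by positivity)
      rw [← Real.rpow_neg ha.le]
      apply Real.rpow_lt_one ha.le ha1
      linarith
    · intro n
      have := term_bound c a p m hc ha g hg (-(n:ℤ))
      rw [zpow_neg (a ^ ((m:ℝ) - p)), zpow_natCast, ← inv_pow] at this
      exact this

/-- Generic weighted series. -/
lemma hasSum_gen (a b H : ℝ) (g : ℝ → ℝ) (m : ℕ) (hb : 0 < b) (ha : 0 < a) (ha1 : a < 1)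
    (hg : ∀ x, 0 < x → |g x| ≤ x ^ m) (hg' : ∀ x, 0 < x → |g x| ≤ x ^ (m + 1))
    (hp : (m:ℝ) < 2 * H) (hp' : 2 * H < m + 1) (g0 : g 0 = 0) (hH : H ≠ 0) (t : ℝ) (ht : 0 ≤ t) :
    HasSum (fun j : ℤ => (b * a ^ j) ^ (-(2 * H)) * g (b * a ^ j * t))
      (t ^ (2 * H) * ∑' j : ℤ, (b * a ^ j * t) ^ (-(2 * H)) * g (b * a ^ j * t)) := by
  rcases ht.eq_or_lt with rfl | ht
  · have : (0:ℝ) ^ (2 * H) = 0 := Real.zero_rpow (by simpa using hH)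
    rw [this, zero_mul]
    simp only [mul_zero, g0]
    exact hasSum_zero
  · have hs := summ_gen (b * t) a (2 * H) m (by positivity) ha ha1 g hg hg' hp hp'
    have e : ∀ j : ℤ, b * t * a ^ j = b * a ^ j * t := fun j => by ring
    simp only [e] at hs
    have := hs.hasSum.mul_left (t ^ (2 * H))
    refine this.congr_fun fun j => ?_
    have hx : 0 < b * a ^ j := by positivity
    rw [Real.mul_rpow hx.le ht.le, Real.rpow_neg ht.le]
    have : t ^ (2 * H) ≠ 0 := (Real.rpow_pos_of_pos ht _).ne'
    field_simp

lemma psd_gen (a b H : ℝ) (g : ℝ → ℝ) (hb : 0 < b) (ha : 0 < a)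
    (G : ℝ → ℝ)
    (hG : ∀ t, 0 ≤ t → HasSum (fun j : ℤ => (b * a ^ j) ^ (-(2 * H)) * g (b * a ^ j * t)) (G t))
    (hK : ∀ s t, 0 ≤ s → 0 ≤ t → g s + g t - (1 / 2) * (g (s + t) + g |s - t|) = Kel s t)
    {n : ℕ} (t c : Fin n → ℝ) (ht : ∀ i, 0 ≤ t i) :
    0 ≤ ∑ i, ∑ k, c i * c k *
      (G (t i) + G (t k) - (1 / 2) * (G (t i + t k) + G |t i - t k|)) := by
  have h1 : ∀ s t, 0 ≤ s → 0 ≤ t → HasSum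
      (fun j : ℤ => (b * a ^ j) ^ (-(2 * H)) * Kel (b * a ^ j * s) (b * a ^ j * t))
      (G s + G t - (1 / 2) * (G (s + t) + G |s - t|)) := by
    intro s t hs ht
    have := ((hG s hs).add (hG t ht)).sub
      (((hG (s + t) (by positivity)).add (hG |s - t| (abs_nonneg _))).mul_left (1 / 2))
    refine this.congr_fun fun j => ?_
    have hx : 0 < b * a ^ j := by positivity
    rw [← hK _ _ (by positivity) (by positivity), ← mul_add (b * a ^ j), ← mul_sub (b * a ^ j),
      abs_mul, abs_of_pos hx]
    ring
  have h2 : HasSum (fun j : ℤ => ∑ i, ∑ k, c i * c k *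
      ((b * a ^ j) ^ (-(2 * H)) * Kel (b * a ^ j * t i) (b * a ^ j * t k)))
      (∑ i, ∑ k, c i * c k *
        (G (t i) + G (t k) - (1 / 2) * (G (t i + t k) + G |t i - t k|))) :=
    hasSum_sum fun i _ => hasSum_sum fun k _ => (h1 _ _ (ht i) (ht k)).mul_left _
  refine h2.nonneg fun j => ?_
  have hx : 0 < b * a ^ j := by positivity
  have h3 := Kel_psd (fun i => b * a ^ j * t i) c (fun i => mul_nonneg hx.le (ht i))
  have h4 := mul_nonneg (Real.rpow_nonneg hx.le (-(2 * H))) h3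
  rw [Finset.mul_sum] at h4
  refine h4.trans_eq (Finset.sum_congr rfl fun i _ => ?_)
  rw [Finset.mul_sum]
  exact Finset.sum_congr rfl fun k _ => by ring

lemma exp_neg_bounds (x : ℝ) (hx : 0 ≤ x) :
    1 - x ≤ Real.exp (-x) ∧ Real.exp (-x) ≤ 1 ∧ Real.exp (-x) ≤ 1 - x + x ^ 2 / 2 ∧
      1 - x + x ^ 2 / 2 - x ^ 3 / 6 ≤ Real.exp (-x) := by
  have hc : ∀ f f' : ℝ → ℝ, (∀ y, HasDerivAt f (f' y) y) → (∀ y, 0 ≤ y → 0 ≤ f' y) →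
      f 0 = 0 → ∀ y, 0 ≤ y → 0 ≤ f y := by
    intro f f' hf hf' h0 y hy
    have : MonotoneOn f (Set.Ici 0) := by
      apply monotoneOn_of_deriv_nonneg (convex_Ici 0)
      · exact fun z _ => (hf z).continuousAt.continuousWithinAt
      · exact fun z _ => (hf z).differentiableAt.differentiableWithinAt
      · intro z hz
        rw [interior_Ici] at hz
        rw [(hf z).deriv]; exact hf' z (le_of_lt hz)
    have := this (Set.mem_Ici.2 le_rfl) (Set.mem_Ici.2 hy) hy
    rwa [h0] at this
  have dexp : ∀ y : ℝ, HasDerivAt (fun y => Real.exp (-y)) (Real.exp (-y) * -1) y :=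
    fun y => (hasDerivAt_id y).neg.exp
  have b1 : ∀ y : ℝ, 1 - y ≤ Real.exp (-y) := fun y => by
    have := Real.add_one_le_exp (-y); linarith
  have b2 := hc (fun y => 1 - y + y ^ 2 / 2 - Real.exp (-y))
    (fun y => -1 + y + Real.exp (-y)) (fun y => by
      have := ((((hasDerivAt_id y).const_sub 1).add
        (((hasDerivAt_id y).pow 2).div_const 2)).sub (dexp y))
      refine this.congr_deriv ?_
      simp) (fun y _ => by linarith [b1 y]) (by simp)
  have b3 := hc (fun y => Real.exp (-y) - (1 - y + y ^ 2 / 2 - y ^ 3 / 6))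
    (fun y => 1 - y + y ^ 2 / 2 - Real.exp (-y)) (fun y => by
      have := (dexp y).sub ((((hasDerivAt_id y).const_sub 1).add
        (((hasDerivAt_id y).pow 2).div_const 2)).sub (((hasDerivAt_id y).pow 3).div_const 6))
      refine this.congr_deriv ?_
      simp; ring) b2 (by simp)
  exact ⟨b1 x, Real.exp_le_one_iff.2 (by linarith), by linarith [b2 x hx], by linarith [b3 x hx]⟩

lemma Kel_one (s t : ℝ) :
    (Real.exp (-s) - 1 + s) + (Real.exp (-t) - 1 + t) - (1 / 2) *
      ((Real.exp (-(s + t)) - 1 + (s + t)) + (Real.exp (-|s - t|) - 1 + |s - t|)) = Kel s t := by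
  unfold Kel
  rcases le_total s t with h | h
  · rw [min_eq_left h, abs_of_nonpos (by linarith : s - t ≤ 0)]; ring
  · rw [min_eq_right h, abs_of_nonneg (by linarith : 0 ≤ s - t)]; ring

theorem stmt9 (a b : ℝ) (ha0 : 0 < a) (ha1 : a < 1) (hb : 0 < b) (H : ℝ) :
    (1 / 2 < H → H < 1 →
      ∀ (n : ℕ), 1 ≤ n → ∀ (t c : Fin n → ℝ), (∀ i, 0 ≤ t i) →
        0 ≤ ∑ i, ∑ k, c i * c k * Qcov a b H (t i) (t k)) ∧
    (1 < H → H < 3 / 2 →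
      ∀ (n : ℕ), 1 ≤ n → ∀ (t c : Fin n → ℝ), (∀ i, 0 ≤ t i) →
        0 ≤ ∑ i, ∑ k, c i * c k * Qtil a b H (t i) (t k)) := by
  constructor
  · intro h1 h2 n _ t c ht
    refine psd_gen a b H (fun x => Real.exp (-x) - 1 + x) hb ha0
      (fun t => t ^ (2 * H) * hosc a b H t) ?_ ?_ t c ht
    · refine hasSum_gen a b H (fun x => Real.exp (-x) - 1 + x) 1 hb ha0 ha1 ?_ ?_ ?_ ?_ ?_ ?_
      · intro x hx
        obtain ⟨e1, e2, e3, e4⟩ := exp_neg_bounds x hx.le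
        simp only [abs_le]
        constructor <;> linarith
      · intro x hx
        obtain ⟨e1, e2, e3, e4⟩ := exp_neg_bounds x hx.le
        have : 0 < x ^ 2 := by positivity
        simp only [abs_le]
        constructor <;> norm_num <;> linarith
      · push_cast; linarith
      · push_cast; linarith
      · simp
      · linarith
    · intro s t _ _
      exact Kel_one s t
  · intro h1 h2 n _ t c ht
    refine psd_gen a b H (fun x => Real.exp (-x) - 1 + x - x ^ 2 / 2) hb ha0
      (fun t => t ^ (2 * H) * htil a b H t) ?_ ?_ t c ht
    · refine hasSum_gen a b H (fun x => Real.exp (-x) - 1 + x - x ^ 2 / 2) 2 hb ha0 ha1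
        ?_ ?_ ?_ ?_ ?_ ?_
      · intro x hx
        obtain ⟨e1, e2, e3, e4⟩ := exp_neg_bounds x hx.le
        simp only [abs_le]
        constructor <;> nlinarith
      · intro x hx
        obtain ⟨e1, e2, e3, e4⟩ := exp_neg_bounds x hx.le
        have : 0 < x ^ 3 := by positivity
        simp only [abs_le]
        constructor <;> norm_num <;> linarith
      · push_cast; linarith
      · push_cast; linarith
      · simp
      · linarith
    · intro s t _ _
      rw [← Kel_one s t]
      simp only [sq_abs]
      ring
end

section
/- For every H in (1/2, 1) and all s, t ≥ 0, the osfBm covariance has the double-integral representation Q_H(s,t) = (1/4) ∫_ℝ ∫_ℝ (1_{[0,s]}(x) - 1_{[-s,0]}(x)) (1_{[0,t]}(y) - 1_{[-t,0]}(y)) Σ_{j∈ℤ} (b a^j)^{2-2H} e^{-|x-y| b a^j} dx dy. -/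
open Real MeasureTheory

/-- The second antiderivative of `l^2 * exp (-(|u| * l))`. -/
noncomputable def FF (l u : ℝ) : ℝ := Real.exp (-(|u| * l)) - 1 + |u| * l

/-- The first antiderivative of `l^2 * exp (-(|u| * l))`. -/
noncomputable def EE (l u : ℝ) : ℝ :=
  l * (Real.exp (-(max (-u) 0 * l)) - Real.exp (-(max u 0 * l)))

/-- The odd indicator kernel. -/
noncomputable def ff (s x : ℝ) : ℝ :=
  (Set.Icc (0:ℝ) s).indicator (fun _ => (1:ℝ)) x
        - (Set.Icc (-s) (0:ℝ)).indicator (fun _ => (1:ℝ)) x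

lemma EE_cont (l : ℝ) : Continuous (EE l) := by unfold EE; fun_prop

lemma FF_cont (l : ℝ) : Continuous (FF l) := by unfold FF; fun_prop

lemma FF_even (l u : ℝ) : FF l (-u) = FF l u := by simp [FF]

lemma exp_lin (c u : ℝ) : HasDerivAt (fun u : ℝ => Real.exp (u * c)) (c * Real.exp (u * c)) u := by
  have := ((hasDerivAt_id u).mul_const c).exp
  simpa [mul_comm] using this

lemma EE_deriv (l u : ℝ) : HasDerivAt (EE l) (l ^ 2 * Real.exp (-(|u| * l))) u := by
  have key : ∀ y : ℝ, y ≠ 0 → HasDerivAt (EE l) (l ^ 2 * Real.exp (-(|y| * l))) y := by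
    intro y hy
    rcases lt_or_gt_of_ne hy with h | h
    · have h1 : HasDerivAt (fun u : ℝ => l * (Real.exp (u * l) - 1)) (l * (l * Real.exp (y * l))) y :=
        ((exp_lin l y).sub_const 1).const_mul l
      have h2 := h1.congr_of_eventuallyEq (f₁ := EE l) (by
        filter_upwards [Iio_mem_nhds h] with z hz
        have hz' : z < 0 := hz
        simp only [EE]
        rw [max_eq_left (by linarith : (0:ℝ) ≤ -z), max_eq_right hz'.le]; simp)
      refine h2.congr_deriv ?_
      rw [abs_of_neg h]; ring_nf
    · have h1 : HasDerivAt (fun u : ℝ => l * (1 - Real.exp (u * (-l)))) (l * (-((-l) * Real.exp (y * (-l))))) y :=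
        ((exp_lin (-l) y).const_sub 1).const_mul l
      have h2 := h1.congr_of_eventuallyEq (f₁ := EE l) (by
        filter_upwards [Ioi_mem_nhds h] with z hz
        have hz' : 0 < z := hz
        simp only [EE]
        rw [max_eq_right (by linarith : -z ≤ (0:ℝ)), max_eq_left hz'.le]; simp)
      refine h2.congr_deriv ?_
      rw [abs_of_pos h]; ring_nf
  by_cases hu : u = 0
  · subst hu
    exact hasDerivAt_of_hasDerivAt_of_ne (g := fun y => l ^ 2 * Real.exp (-(|y| * l))) key (EE_cont l).continuousAt
      (by fun_prop)
  · exact key u hu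

lemma FF_deriv (l u : ℝ) : HasDerivAt (FF l) (EE l u) u := by
  have key : ∀ y : ℝ, y ≠ 0 → HasDerivAt (FF l) (EE l y) y := by
    intro y hy
    rcases lt_or_gt_of_ne hy with h | h
    · have h1 : HasDerivAt (fun u : ℝ => Real.exp (u * l) - 1 + u * (-l)) (l * Real.exp (y * l) + 1 * (-l)) y :=
        ((exp_lin l y).sub_const 1).add ((hasDerivAt_id y).mul_const (-l))
      have h2 := h1.congr_of_eventuallyEq (f₁ := FF l) (by
        filter_upwards [Iio_mem_nhds h] with z hz
        have hz' : z < 0 := hz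
        simp only [FF]
        rw [abs_of_neg hz']; simp)
      refine h2.congr_deriv ?_
      simp only [EE]
      rw [max_eq_left (by linarith : (0:ℝ) ≤ -y), max_eq_right h.le]; simp; ring
    · have h1 : HasDerivAt (fun u : ℝ => Real.exp (u * (-l)) - 1 + u * l) ((-l) * Real.exp (y * (-l)) + 1 * l) y :=
        ((exp_lin (-l) y).sub_const 1).add ((hasDerivAt_id y).mul_const l)
      have h2 := h1.congr_of_eventuallyEq (f₁ := FF l) (by
        filter_upwards [Ioi_mem_nhds h] with z hz
        have hz' : 0 < z := hz
        simp only [FF]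
        rw [abs_of_pos hz']; simp)
      refine h2.congr_deriv ?_
      simp only [EE]
      rw [max_eq_right (by linarith : -y ≤ (0:ℝ)), max_eq_left h.le]; simp; ring
  by_cases hu : u = 0
  · subst hu
    exact hasDerivAt_of_hasDerivAt_of_ne key (FF_cont l).continuousAt (EE_cont l).continuousAt
  · exact key u hu

lemma EE_abs (l u : ℝ) (hl : 0 < l) : |EE l u| ≤ l := by
  have h : ∀ v : ℝ, Real.exp (-(max v 0 * l)) ≤ 1 := fun v => by
    rw [Real.exp_le_one_iff]
    have : 0 ≤ max v 0 * l := by positivity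
    linarith
  have h1 := h u
  have h2 := h (-u)
  have p1 := Real.exp_pos (-(max u 0 * l))
  have p2 := Real.exp_pos (-(max (-u) 0 * l))
  unfold EE
  rw [abs_mul, abs_of_pos hl]
  have : |Real.exp (-(max (-u) 0 * l)) - Real.exp (-(max u 0 * l))| ≤ 1 := by
    rw [abs_le]; constructor <;> linarith
  nlinarith

lemma int_exp (l p q y : ℝ) (hl : 0 < l) :
    ∫ x in p..q, Real.exp (-(|x - y| * l)) = (l ^ 2)⁻¹ * (EE l (q - y) - EE l (p - y)) := by
  have h : ∀ x ∈ Set.uIcc p q, HasDerivAt (fun x => (l ^ 2)⁻¹ * EE l (x - y)) (Real.exp (-(|x - y| * l))) x := by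
    intro x _
    have h1 := ((EE_deriv l (x - y)).comp_sub_const x y).const_mul (l ^ 2)⁻¹
    refine h1.congr_deriv ?_
    field_simp
  rw [intervalIntegral.integral_eq_sub_of_hasDerivAt h]
  · ring
  · exact Continuous.intervalIntegrable (by fun_prop) _ _

lemma int_EE (l p q c : ℝ) :
    ∫ y in p..q, EE l (c - y) = FF l (c - p) - FF l (c - q) := by
  have h : ∀ x ∈ Set.uIcc p q, HasDerivAt (fun y => - FF l (c - y)) (EE l (c - x)) x := by
    intro x _
    have h1 := ((FF_deriv l (c - x)).comp_const_sub c x).neg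
    exact h1.congr_deriv (by simp)
  rw [intervalIntegral.integral_eq_sub_of_hasDerivAt h]
  · ring
  · exact Continuous.intervalIntegrable ((EE_cont l).comp (by fun_prop)) _ _

lemma ff_mul (s x : ℝ) (g : ℝ → ℝ) : ff s x * g x =
    (Set.Icc (0:ℝ) s).indicator g x - (Set.Icc (-s) (0:ℝ)).indicator g x := by
  unfold ff Set.indicator
  split_ifs <;> simp

lemma ff_integrable (s : ℝ) (g : ℝ → ℝ) (hg : Continuous g) : Integrable (fun x => ff s x * g x) := by
  simp only [ff_mul]
  exact ((hg.integrableOn_Icc).integrable_indicator measurableSet_Icc).sub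
    ((hg.integrableOn_Icc).integrable_indicator measurableSet_Icc)

lemma ff_integral (s : ℝ) (hs : 0 ≤ s) (g : ℝ → ℝ) (hg : Continuous g) :
    ∫ x, ff s x * g x = (∫ x in (0:ℝ)..s, g x) - ∫ x in (-s)..0, g x := by
  simp only [ff_mul]
  rw [integral_sub ((hg.integrableOn_Icc).integrable_indicator measurableSet_Icc)
    ((hg.integrableOn_Icc).integrable_indicator measurableSet_Icc),
    integral_indicator measurableSet_Icc, integral_indicator measurableSet_Icc,
    intervalIntegral.integral_of_le hs, intervalIntegral.integral_of_le (by linarith),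
    integral_Icc_eq_integral_Ioc, integral_Icc_eq_integral_Ioc]

lemma ff_abs_le (s x : ℝ) (hs : 0 ≤ s) (g : ℝ → ℝ) (hg : ∀ x, 0 ≤ g x) :
    ‖ff s x * g x‖ ≤ (Set.Icc (-s) s).indicator g x := by
  have h := hg x
  rw [ff_mul, Real.norm_eq_abs]
  unfold Set.indicator
  simp only [Set.mem_Icc]
  split_ifs <;> first | (exfalso; grind) | (simp [abs_of_nonneg h, h]; done)

lemma ff_norm_integral (s : ℝ) (hs : 0 ≤ s) (g : ℝ → ℝ) (hg : Continuous g) (h0 : ∀ x, 0 ≤ g x) :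
    ∫ x, ‖ff s x * g x‖ ≤ ∫ x in (-s)..s, g x := by
  calc _ ≤ ∫ x, (Set.Icc (-s) s).indicator g x := by
        apply integral_mono (ff_integrable s g hg).norm
          ((hg.integrableOn_Icc).integrable_indicator measurableSet_Icc)
        intro x
        exact ff_abs_le s x hs g h0
    _ = _ := by
        rw [integral_indicator measurableSet_Icc,
          intervalIntegral.integral_of_le (by linarith), integral_Icc_eq_integral_Ioc]

/-- inner integral -/
noncomputable def II (l s y : ℝ) : ℝ := (l ^ 2)⁻¹ * (EE l (s - y) - 2 * EE l (0 - y) + EE l (-s - y))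

lemma II_eq (l s y : ℝ) (hl : 0 < l) (hs : 0 ≤ s) :
    ∫ x, ff s x * Real.exp (-(|x - y| * l)) = II l s y := by
  rw [ff_integral s hs _ (by fun_prop), int_exp l _ _ _ hl, int_exp l _ _ _ hl, II]
  ring

lemma inner_bd (l s y : ℝ) (hl : 0 < l) (hs : 0 ≤ s) :
    ∫ x, ‖ff s x * Real.exp (-(|x - y| * l))‖ ≤ (2 * s + 2) * (min l (l ^ 2) * (l ^ 2)⁻¹) := by
  have h := ff_norm_integral s hs (fun x => Real.exp (-(|x - y| * l))) (by fun_prop)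
    (fun x => (Real.exp_pos _).le)
  refine h.trans ?_
  rcases min_cases l (l ^ 2) with ⟨h1, _⟩ | ⟨h1, _⟩
  · rw [h1, int_exp l _ _ _ hl]
    have e1 := abs_le.1 (EE_abs l (s - y) hl)
    have e2 := abs_le.1 (EE_abs l (-s - y) hl)
    have : EE l (s - y) - EE l (-s - y) ≤ (2 * s + 2) * l := by nlinarith
    calc _ ≤ (l ^ 2)⁻¹ * ((2 * s + 2) * l) := by gcongr
      _ = _ := by ring
  · rw [h1, mul_inv_cancel₀ (by positivity)]
    have : ∫ x in (-s)..s, Real.exp (-(|x - y| * l)) ≤ ∫ x in (-s)..s, (1:ℝ) := by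
      apply intervalIntegral.integral_mono_on (by linarith)
        (Continuous.intervalIntegrable (by fun_prop) _ _) (by simp)
      intro x _
      rw [Real.exp_le_one_iff]
      have : 0 ≤ |x - y| * l := by positivity
      linarith
    simp at this
    simp
    linarith

lemma II_cont (l s : ℝ) : Continuous (II l s) := by
  have := EE_cont l
  unfold II
  fun_prop

lemma outer_eq (l s t : ℝ) (ht : 0 ≤ t) :
    ∫ y, ff t y * II l s y =
      (l ^ 2)⁻¹ * (4 * FF l s + 4 * FF l t - 2 * FF l (s + t) - 2 * FF l (s - t)) := by
  have hc := EE_cont l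
  have hi : ∀ p q : ℝ, ∫ y in p..q, II l s y = (l ^ 2)⁻¹ *
      ((FF l (s - p) - FF l (s - q)) - 2 * (FF l (0 - p) - FF l (0 - q))
        + (FF l (-s - p) - FF l (-s - q))) := by
    intro p q
    unfold II
    have i1 : ∀ c, IntervalIntegrable (fun y => EE l (c - y)) volume p q := fun c =>
      Continuous.intervalIntegrable (by fun_prop) _ _
    rw [intervalIntegral.integral_const_mul, intervalIntegral.integral_add
      ((i1 s).sub ((i1 0).const_mul 2)) (i1 (-s)),
      intervalIntegral.integral_sub (i1 s) ((i1 0).const_mul 2),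
      intervalIntegral.integral_const_mul, int_EE, int_EE, int_EE]
  rw [ff_integral t ht _ (II_cont l s), hi, hi]
  have e1 : FF l (-s) = FF l s := FF_even l s
  have e2 : FF l (-s - t) = FF l (s + t) := by rw [← FF_even]; congr 1; ring
  have e3 : FF l (-s - -t) = FF l (s - t) := by rw [← FF_even]; congr 1; ring
  have e4 : FF l (0 - t) = FF l t := by rw [← FF_even]; congr 1; ring
  have e5 : FF l (0 - -t) = FF l t := by congr 1; ring
  have e6 : FF l (s - -t) = FF l (s + t) := by congr 1; ring
  have e7 : FF l 0 = 0 := by simp [FF]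
  simp only [e1, e2, e3, e4, e5, e6, sub_zero, e7]
  ring

lemma FF_nonneg (l u : ℝ) : 0 ≤ FF l u := by
  have := Real.add_one_le_exp (-(|u| * l))
  unfold FF; linarith

lemma FF_bd (l u : ℝ) (hl : 0 < l) : FF l u ≤ (|u| + u ^ 2) * min l (l ^ 2) := by
  have hx : 0 ≤ |u| * l := by positivity
  have h1 : FF l u ≤ |u| * l := by
    have : Real.exp (-(|u| * l)) ≤ 1 := by rw [Real.exp_le_one_iff]; linarith
    unfold FF; linarith
  have h2 : FF l u ≤ u ^ 2 * l ^ 2 := by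
    have : u ^ 2 * l ^ 2 = (|u| * l) ^ 2 := by rw [mul_pow, sq_abs]
    rw [this]
    by_cases h : |u| * l ≤ 1
    · have := Real.abs_exp_sub_one_sub_id_le (x := -(|u| * l)) (by rwa [abs_neg, abs_of_nonneg hx])
      have := (abs_le.1 this).2
      unfold FF; nlinarith
    · nlinarith
  rcases min_cases l (l ^ 2) with ⟨h, _⟩ | ⟨h, _⟩ <;> rw [h] <;> have := abs_nonneg u <;> nlinarith [sq_nonneg u, sq_nonneg l]

lemma geo (a b p : ℝ) (ha0 : 0 < a) (ha1 : a < 1) (hb : 0 < b) (hp : 0 < p) :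
    Summable (fun n : ℕ => (b * a ^ n) ^ p) := by
  have : (fun n : ℕ => (b * a ^ n) ^ p) = fun n : ℕ => b ^ p * (a ^ p) ^ n := by
    funext n
    rw [Real.mul_rpow hb.le (by positivity), ← Real.rpow_natCast, ← Real.rpow_natCast,
      ← Real.rpow_mul ha0.le, ← Real.rpow_mul ha0.le, mul_comm p]
  rw [this]
  exact (summable_geometric_of_lt_one (by positivity) (Real.rpow_lt_one ha0.le ha1 hp)).mul_left _

lemma key_summable (a b H : ℝ) (ha0 : 0 < a) (ha1 : a < 1) (hb : 0 < b)
    (hH1 : 1 / 2 < H) (hH2 : H < 1) :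
    Summable (fun j : ℤ => (b * a ^ j) ^ (-(2 * H)) * min (b * a ^ j) ((b * a ^ j) ^ 2)) := by
  apply Summable.of_nat_of_neg
  · refine Summable.of_nonneg_of_le (fun n => by positivity) (fun n => ?_)
      (geo a b (2 - 2 * H) ha0 ha1 hb (by linarith))
    have hl : 0 < b * a ^ n := by positivity
    rw [zpow_natCast, show 2 - 2 * H = -(2 * H) + (2:ℕ) by push_cast; ring, Real.rpow_add_natCast hl.ne']
    gcongr
    exact min_le_right _ _
  · refine Summable.of_nonneg_of_le (fun n => by positivity) (fun n => ?_)
      (geo a b⁻¹ (2 * H - 1) ha0 ha1 (by positivity) (by linarith))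
    have hl : 0 < b * a ^ (-(n:ℤ)) := by positivity
    have : b⁻¹ * a ^ n = (b * a ^ (-(n:ℤ)))⁻¹ := by rw [mul_inv, zpow_neg, inv_inv, zpow_natCast]
    rw [this, Real.inv_rpow hl.le, ← Real.rpow_neg hl.le,
      show -(2 * H - 1) = -(2 * H) + (1:ℕ) by push_cast; ring, Real.rpow_add_natCast hl.ne', pow_one]
    gcongr
    exact min_le_left _ _

lemma hosc_eq (a b H t : ℝ) (ha0 : 0 < a) (hb : 0 < b) (hH1 : 1 / 2 < H) (ht : 0 ≤ t) :
    t ^ (2 * H) * hosc a b H t = ∑' j : ℤ, (b * a ^ j) ^ (-(2 * H)) * FF (b * a ^ j) t := by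
  rcases ht.eq_or_lt with h | h
  · subst h
    simp [FF, Real.zero_rpow (by linarith : (2 * H) ≠ 0), hosc]
  · unfold hosc
    rw [← tsum_mul_left]
    congr 1; funext j
    have hl : 0 < b * a ^ j := by positivity
    rw [Real.mul_rpow hl.le h.le, Real.rpow_neg h.le, FF, abs_of_pos h, mul_comm t]
    have : t ^ (2 * H) ≠ 0 := by positivity
    field_simp

lemma FF_summable (a b H u : ℝ) (ha0 : 0 < a) (ha1 : a < 1) (hb : 0 < b)
    (hH1 : 1 / 2 < H) (hH2 : H < 1) :
    Summable (fun j : ℤ => (b * a ^ j) ^ (-(2 * H)) * FF (b * a ^ j) u) := by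
  refine Summable.of_nonneg_of_le (fun j => ?_) (fun j => ?_)
    ((key_summable a b H ha0 ha1 hb hH1 hH2).mul_left (|u| + u ^ 2))
  · have := FF_nonneg (b * a ^ j) u
    positivity
  · have hl : 0 < b * a ^ j := by positivity
    calc _ ≤ (b * a ^ j) ^ (-(2 * H)) * ((|u| + u ^ 2) * min (b * a ^ j) ((b * a ^ j) ^ 2)) := by
          gcongr; exact FF_bd _ _ hl
      _ = _ := by ring

lemma L_eq (l H : ℝ) (hl : 0 < l) : l ^ (2 - 2 * H) = l ^ (-(2 * H)) * l ^ 2 := by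
  rw [show 2 - 2 * H = -(2 * H) + (2:ℕ) by push_cast; ring, Real.rpow_add_natCast hl.ne']

lemma inner_sum_eq (a b H s y c : ℝ) (ha0 : 0 < a) (ha1 : a < 1) (hb : 0 < b)
    (hH1 : 1 / 2 < H) (hH2 : H < 1) (hs : 0 ≤ s) :
    ∫ x : ℝ, ff s x * c *
      ∑' j : ℤ, (b * a ^ j) ^ (2 - 2 * H) * Real.exp (-(|x - y| * (b * a ^ j)))
    = ∑' j : ℤ, c * ((b * a ^ j) ^ (2 - 2 * H) * II (b * a ^ j) s y) := by
  have hl : ∀ j : ℤ, 0 < b * a ^ j := fun j => by positivity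
  have e : ∀ x, ff s x * c *
      ∑' j : ℤ, (b * a ^ j) ^ (2 - 2 * H) * Real.exp (-(|x - y| * (b * a ^ j))) =
      c * ∑' j : ℤ, (b * a ^ j) ^ (2 - 2 * H) * (ff s x * Real.exp (-(|x - y| * (b * a ^ j)))) := by
    intro x
    rw [mul_comm (ff s x), mul_assoc, ← tsum_mul_left]
    congr 2; funext j; ring
  simp only [e]
  rw [integral_const_mul, tsum_mul_left]
  congr 1
  rw [← (hasSum_integral_of_summable_integral_norm (μ := volume) (F := fun (j : ℤ) (x : ℝ) =>
    (b * a ^ j) ^ (2 - 2 * H) * (ff s x * Real.exp (-(|x - y| * (b * a ^ j))))) ?_ ?_).tsum_eq]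
  · congr 1; funext j
    rw [integral_const_mul, II_eq _ _ _ (hl j) hs]
  · intro j
    exact (ff_integrable s _ (by fun_prop)).const_mul _
  · refine Summable.of_nonneg_of_le (fun j => by positivity) (fun j => ?_)
      ((key_summable a b H ha0 ha1 hb hH1 hH2).mul_left (2 * s + 2))
    have h0 := hl j
    simp only [norm_mul ((b * a ^ j) ^ (2 - 2 * H))]
    rw [integral_const_mul, Real.norm_of_nonneg (by positivity), L_eq _ _ h0]
    calc _ ≤ (b * a ^ j) ^ (-(2 * H)) * (b * a ^ j) ^ 2 * ((2 * s + 2) *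
          (min (b * a ^ j) ((b * a ^ j) ^ 2) * ((b * a ^ j) ^ 2)⁻¹)) := by
          gcongr; exact inner_bd _ _ _ h0 hs
      _ = _ := by
          generalize b * a ^ j = l at *
          field_simp

lemma outer_sum (a b H s t : ℝ) (ha0 : 0 < a) (ha1 : a < 1) (hb : 0 < b)
    (hH1 : 1 / 2 < H) (hH2 : H < 1) (hs : 0 ≤ s) :
    ∫ y : ℝ, ∑' j : ℤ, ff t y * ((b * a ^ j) ^ (2 - 2 * H) * II (b * a ^ j) s y)
    = ∑' j : ℤ, (b * a ^ j) ^ (2 - 2 * H) * ∫ y, ff t y * II (b * a ^ j) s y := by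
  have hl : ∀ j : ℤ, 0 < b * a ^ j := fun j => by positivity
  have hint : ∀ j : ℤ, Integrable (fun y => ff t y * ((b * a ^ j) ^ (2 - 2 * H) * II (b * a ^ j) s y)) :=
    fun j => ff_integrable t _ (continuous_const.mul (II_cont _ _))
  have h1 : Integrable (fun y => ff t y) := by simpa using ff_integrable t (fun _ => 1) continuous_const
  rw [← (hasSum_integral_of_summable_integral_norm (μ := volume) (F := fun (j : ℤ) (y : ℝ) =>
    ff t y * ((b * a ^ j) ^ (2 - 2 * H) * II (b * a ^ j) s y)) hint ?_).tsum_eq]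
  · congr 1; funext j
    rw [← integral_const_mul]
    congr 1; funext y; ring
  · refine Summable.of_nonneg_of_le (fun j => by positivity) (fun j => ?_)
      ((key_summable a b H ha0 ha1 hb hH1 hH2).mul_left ((∫ y, ‖ff t y‖) * (2 * s + 2)))
    have h0 := hl j
    rw [mul_assoc, ← integral_mul_const]
    refine integral_mono (hint j).norm (h1.norm.mul_const _) (fun y => ?_)
    simp only [norm_mul (ff t y)]
    gcongr
    rw [norm_mul, Real.norm_of_nonneg (by positivity), L_eq _ _ h0]
    have hb2 : ‖II (b * a ^ j) s y‖ ≤ (2 * s + 2) *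
          (min (b * a ^ j) ((b * a ^ j) ^ 2) * ((b * a ^ j) ^ 2)⁻¹) := by
      rw [← II_eq _ _ _ h0 hs]
      exact (norm_integral_le_integral_norm _).trans (inner_bd _ _ _ h0 hs)
    calc _ ≤ (b * a ^ j) ^ (-(2 * H)) * (b * a ^ j) ^ 2 * ((2 * s + 2) *
          (min (b * a ^ j) ((b * a ^ j) ^ 2) * ((b * a ^ j) ^ 2)⁻¹)) := by
          gcongr
      _ = _ := by
          generalize b * a ^ j = l at *
          field_simp

theorem stmt11 (a b : ℝ) (ha0 : 0 < a) (ha1 : a < 1) (hb : 0 < b)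
    (H : ℝ) (hH1 : 1 / 2 < H) (hH2 : H < 1) (s t : ℝ) (hs : 0 ≤ s) (ht : 0 ≤ t) :
    Qcov a b H s t = (1 / 4) * ∫ y : ℝ, ∫ x : ℝ,
      ((Set.Icc (0:ℝ) s).indicator (fun _ => (1:ℝ)) x
        - (Set.Icc (-s) (0:ℝ)).indicator (fun _ => (1:ℝ)) x) *
      ((Set.Icc (0:ℝ) t).indicator (fun _ => (1:ℝ)) y
        - (Set.Icc (-t) (0:ℝ)).indicator (fun _ => (1:ℝ)) y) *
      ∑' j : ℤ, (b * a ^ j) ^ (2 - 2 * H) * Real.exp (-(|x - y| * (b * a ^ j))) := by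
  have e : ∀ y x : ℝ, ((Set.Icc (0:ℝ) s).indicator (fun _ => (1:ℝ)) x
        - (Set.Icc (-s) (0:ℝ)).indicator (fun _ => (1:ℝ)) x) *
      ((Set.Icc (0:ℝ) t).indicator (fun _ => (1:ℝ)) y
        - (Set.Icc (-t) (0:ℝ)).indicator (fun _ => (1:ℝ)) y) = ff s x * ff t y := fun _ _ => rfl
  simp only [e]
  simp only [inner_sum_eq a b H s _ _ ha0 ha1 hb hH1 hH2 hs]
  rw [outer_sum a b H s t ha0 ha1 hb hH1 hH2 hs]
  simp only [outer_eq _ _ _ ht]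
  have S := fun u => FF_summable a b H u ha0 ha1 hb hH1 hH2
  have ev : ∀ l, FF l |s - t| = FF l (s - t) := fun l => by simp [FF]
  unfold Qcov
  rw [hosc_eq a b H s ha0 hb hH1 hs, hosc_eq a b H t ha0 hb hH1 ht,
    hosc_eq a b H (s + t) ha0 hb hH1 (by linarith), hosc_eq a b H |s - t| ha0 hb hH1 (abs_nonneg _)]
  simp only [ev]
  rw [← (S s).tsum_add (S t), ← (S (s + t)).tsum_add (S (s - t)), ← tsum_mul_left,
    ← ((S s).add (S t)).tsum_sub (((S (s + t)).add (S (s - t))).mul_left _), ← tsum_mul_left]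
  congr 1; funext j
  have hl : 0 < b * a ^ j := by positivity
  rw [L_eq _ _ hl]
  generalize b * a ^ j = l at *
  field_simp
  ring
end
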